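/- arXiv:1705.01146 — 8 statements merged into one kernel-verified Lean document; each statement's English description precedes it below -/
import Mathlib

section
/- There exist constants K > 0 and n₀ ∈ ℕ such that for every integer n ≥ n₀ and every node v₀ ∈ Fin n, the push–pull broadcast started from the single informed node v₀ informs all nodes within ⌈K·n·log n⌉ steps (i.e., O(log n) periods) with probability at least 1 − K·(log n)²/n: μ_n({ω : I_ω^{{v₀}}(⌈K·n·log n⌉) = Fin n}) ≥ 1 − K·(log n)²/n. -/
open MeasureTheory ProbabilityTheory

noncomputable section

/-- The uniform probability measure on the set of ordered pairs of distinct nodes. -/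
def pairUniform (n : ℕ) : Measure (Fin n × Fin n) :=
  uniformOn {p : Fin n × Fin n | p.1 ≠ p.2}

/-- `μ` is the random-scheduler measure `μ_n`: it is a probability measure on the sequence
space `(Fin n × Fin n)^ℕ` under which the coordinate maps (the pairs selected at each time
step) are mutually independent and each is uniformly distributed on the set of ordered pairs
of distinct nodes, i.e. `μ` is the countable product of the uniform measure on that set. -/
def IsSchedulerMeasure (n : ℕ) (μ : Measure (ℕ → Fin n × Fin n)) : Prop :=
  IsProbabilityMeasure μ ∧
  iIndepFun (fun t (ω : ℕ → Fin n × Fin n) => ω t) μ ∧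
  ∀ t : ℕ, Measure.map (fun ω => ω t) μ = pairUniform n

/-- The informed set `I_ω^S(t)` of the push–pull broadcast: starting from `S`, whenever the
selected pair contains an informed node, both nodes of the pair become informed. -/
def informed (n : ℕ) (ω : ℕ → Fin n × Fin n) (S : Finset (Fin n)) : ℕ → Finset (Fin n)
  | 0 => S
  | t + 1 =>
      let I := informed n ω S t
      if (ω t).1 ∈ I ∨ (ω t).2 ∈ I then insert (ω t).1 (insert (ω t).2 I) else I

def ppStep (n : ℕ) (I : Finset (Fin n)) (p : Fin n × Fin n) : Finset (Fin n) :=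
  if p.1 ∈ I ∨ p.2 ∈ I then insert p.1 (insert p.2 I) else I

def ppPot (n : ℕ) (I : Finset (Fin n)) : ℝ := ((n : ℝ) - I.card) / I.card

lemma ppPot_nonneg (n : ℕ) (I : Finset (Fin n)) : 0 ≤ ppPot n I := by
  have h : I.card ≤ n := by simpa using Finset.card_le_univ I
  have h' : (I.card : ℝ) ≤ n := by exact_mod_cast h
  unfold ppPot
  exact div_nonneg (by linarith) (by positivity)

lemma informed_succ' (n : ℕ) (ω : ℕ → Fin n × Fin n) (S : Finset (Fin n)) (t : ℕ) :
    informed n ω S (t+1) = ppStep n (informed n ω S t) (ω t) := rfl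

lemma informed_nonempty' (n : ℕ) (ω : ℕ → Fin n × Fin n) (S : Finset (Fin n)) (hS : S.Nonempty)
    (t : ℕ) : (informed n ω S t).Nonempty := by
  induction t with
  | zero => exact hS
  | succ t ih =>
    rw [informed_succ', ppStep]
    split_ifs
    · exact Finset.insert_nonempty _ _
    · exact ih

lemma informed_congr' (n : ℕ) (ω ω' : ℕ → Fin n × Fin n) (S : Finset (Fin n)) (t : ℕ)
    (h : ∀ i < t, ω i = ω' i) : informed n ω S t = informed n ω' S t := by
  induction t with
  | zero => rfl
  | succ t ih =>
    rw [informed_succ', informed_succ', ih (fun i hi => h i (by omega)), h t (by omega)]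

lemma ppStep_pot (n : ℕ) (I : Finset (Fin n)) (p : Fin n × Fin n) :
    ppPot n (ppStep n I p) = ppPot n I -
      ((if p ∈ I ×ˢ Iᶜ then 1 else 0) + (if p ∈ Iᶜ ×ˢ I then 1 else 0)) *
        (ppPot n I - ((n : ℝ) - (I.card + 1)) / (I.card + 1)) := by
  obtain ⟨a, b⟩ := p
  by_cases ha : a ∈ I <;> by_cases hb : b ∈ I <;>
    simp [ppStep, ha, hb, ppPot]

lemma ppStep_sum (n : ℕ) (I : Finset (Fin n)) (hI : I.Nonempty) :
    ∑ p ∈ (Finset.univ : Finset (Fin n)).offDiag, ppPot n (ppStep n I p) ≤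
      (n * n - n) * ((1 - 1 / n) * ppPot n I) := by
  have hk : 0 < I.card := hI.card_pos
  have hkn : I.card ≤ n := by simpa using Finset.card_le_univ I
  have e1 : (Finset.univ : Finset (Fin n)).offDiag ∩ (I ×ˢ Iᶜ) = I ×ˢ Iᶜ := by
    ext ⟨a, b⟩
    simp only [Finset.mem_inter, Finset.mem_offDiag, Finset.mem_product, Finset.mem_compl,
      Finset.mem_univ, true_and]
    grind
  have e2 : (Finset.univ : Finset (Fin n)).offDiag ∩ (Iᶜ ×ˢ I) = Iᶜ ×ˢ I := by
    ext ⟨a, b⟩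
    simp only [Finset.mem_inter, Finset.mem_offDiag, Finset.mem_product, Finset.mem_compl,
      Finset.mem_univ, true_and]
    grind
  simp_rw [ppStep_pot]
  rw [Finset.sum_sub_distrib, ← Finset.sum_mul, Finset.sum_add_distrib, Finset.sum_ite_mem,
    Finset.sum_ite_mem, e1, e2]
  simp only [Finset.sum_const, Finset.card_product, Finset.card_compl, Finset.offDiag_card,
    Finset.card_univ, Fintype.card_fin, nsmul_eq_mul, mul_one]
  rw [Nat.cast_sub (Nat.le_mul_self n)]
  push_cast [Nat.cast_sub hkn]
  unfold ppPot
  generalize I.card = k at *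
  have h1 : (1:ℝ) ≤ k := by exact_mod_cast hk
  have h2 : (k:ℝ) ≤ n := by exact_mod_cast hkn
  have h3 : (0:ℝ) < k + 1 := by linarith
  have h4 : (0:ℝ) < n := by linarith
  have h5 : (0:ℝ) < k := by linarith
  have : ((n:ℝ) * n - n) * ((1 - 1 / n) * ((n - k) / k)) - (((n:ℝ) * n - n) * ((n - k) / k) -
      (k * (n - k) + (n - k) * k) * ((n - k) / k - (n - (k + 1)) / (k + 1)))
      = (n - k) * ((2 * n * k - (n - 1) * (k+1)) / (k * (k+1))) := by
    field_simp
    ring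
  have h6 : 0 ≤ ((n:ℝ) - k) * ((2 * n * k - (n - 1) * (k+1)) / (k * (k+1))) := by
    apply mul_nonneg (by linarith)
    apply div_nonneg _ (by positivity)
    nlinarith
  linarith

lemma pairUniform_integral (n : ℕ) (hn : 2 ≤ n) (f : Fin n × Fin n → ℝ) :
    ∫ p, f p ∂(pairUniform n) =
      ((n * n - n : ℝ))⁻¹ * ∑ p ∈ (Finset.univ : Finset (Fin n)).offDiag, f p := by
  have hs : {p : Fin n × Fin n | p.1 ≠ p.2} =
      (((Finset.univ : Finset (Fin n)).offDiag : Finset (Fin n × Fin n)) : Set (Fin n × Fin n)) := by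
    ext p; simp
  rw [pairUniform, hs, uniformOn, ProbabilityTheory.cond, integral_smul_measure,
    Measure.count_apply_finset, setIntegral_finset]
  · simp only [Finset.offDiag_card, Finset.card_univ, Fintype.card_fin, smul_eq_mul]
    rw [ENNReal.toReal_inv, ENNReal.toReal_natCast, Nat.cast_sub (Nat.le_mul_self n)]
    simp [Measure.real]
  · exact (Integrable.of_finite).integrableOn

lemma pp_recur (n : ℕ) (hn : 2 ≤ n) (μ : Measure (ℕ → Fin n × Fin n)) (hμ : IsSchedulerMeasure n μ)
    (S : Finset (Fin n)) (hS : S.Nonempty) (t : ℕ) :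
    Integrable (fun ω => ppPot n (informed n ω S t)) μ ∧
    ∫ ω, ppPot n (informed n ω S (t+1)) ∂μ ≤ (1 - 1 / n) * ∫ ω, ppPot n (informed n ω S t) ∂μ := by
  obtain ⟨hp, hind, hmap⟩ := hμ
  let d : Fin n × Fin n := (⟨0, by omega⟩, ⟨0, by omega⟩)
  let E : (Finset.range t → Fin n × Fin n) → (ℕ → Fin n × Fin n) :=
    fun x i => if h : i ∈ Finset.range t then x ⟨i, h⟩ else d
  let X : (ℕ → Fin n × Fin n) → (Finset.range t → Fin n × Fin n) := fun ω i => ω i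
  have hX : Measurable X := by fun_prop
  have hE : ∀ ω, informed n (E (X ω)) S t = informed n ω S t := fun ω =>
    informed_congr' n _ _ S t (fun i hi => by simp [E, X, hi])
  have hi : IndepFun X (fun ω => ω t) μ := by
    have := hind.indepFun_finset (Finset.range t) {t} (by simp) (fun i => by fun_prop)
    exact this.comp (φ := id) (ψ := fun y : ((({t} : Finset ℕ) → Fin n × Fin n)) => y ⟨t, by simp⟩)
      measurable_id (measurable_pi_apply _)
  have hY : Measurable (fun ω : ℕ → Fin n × Fin n => ω t) := by fun_prop
  have hpr := (indepFun_iff_map_prod_eq_prod_map_map hX.aemeasurable hY.aemeasurable).1 hi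
  rw [hmap t] at hpr
  have : IsProbabilityMeasure (pairUniform n) := by
    rw [← hmap t]; exact Measure.isProbabilityMeasure_map hY.aemeasurable
  have : IsProbabilityMeasure (Measure.map X μ) := Measure.isProbabilityMeasure_map hX.aemeasurable
  let g : (Finset.range t → Fin n × Fin n) → ℝ := fun x => ppPot n (informed n (E x) S t)
  have hg : ∀ ω, ppPot n (informed n ω S t) = g (X ω) := fun ω => by simp only [g, hE]
  have hgm : Measurable g := measurable_of_finite g
  constructor
  · simp_rw [hg]
    have : Integrable g (Measure.map X μ) := Integrable.of_finite
    exact this.comp_measurable hX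
  · have h1 : ∫ ω, ppPot n (informed n ω S (t+1)) ∂μ =
        ∫ x, ∫ p, ppPot n (ppStep n (informed n (E x) S t) p) ∂(pairUniform n) ∂(Measure.map X μ) := by
      let G : (Finset.range t → Fin n × Fin n) × (Fin n × Fin n) → ℝ :=
        fun z => ppPot n (ppStep n (informed n (E z.1) S t) z.2)
      have hG : Integrable G ((Measure.map X μ).prod (pairUniform n)) := Integrable.of_finite
      rw [← integral_prod G hG, ← hpr,
        integral_map (hX.prodMk hY).aemeasurable (measurable_of_finite G).aestronglyMeasurable]
      simp only [G, hE, informed_succ']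
    have h2 : ∫ ω, ppPot n (informed n ω S t) ∂μ = ∫ x, g x ∂(Measure.map X μ) := by
      rw [integral_map hX.aemeasurable hgm.aestronglyMeasurable]
      simp_rw [hg]
    rw [h1, h2, ← integral_const_mul]
    refine integral_mono Integrable.of_finite Integrable.of_finite (fun x => ?_)
    have hn' : (2:ℝ) ≤ n := by exact_mod_cast hn
    have hpos : (0:ℝ) < n * n - n := by nlinarith
    simp only [pairUniform_integral n hn]
    rw [inv_mul_le_iff₀ hpos]
    exact ppStep_sum n _ (informed_nonempty' n _ S hS t)

lemma pp_bound (n : ℕ) (hn : 2 ≤ n) (μ : Measure (ℕ → Fin n × Fin n)) (hμ : IsSchedulerMeasure n μ)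
    (v : Fin n) (t : ℕ) :
    ∫ ω, ppPot n (informed n ω {v} t) ∂μ ≤ (1 - 1 / n) ^ t * n := by
  have hn' : (2:ℝ) ≤ n := by exact_mod_cast hn
  have := hμ.1
  induction t with
  | zero => simp [informed, ppPot]
  | succ t ih =>
    refine (pp_recur n hn μ hμ {v} (by simp) t).2.trans ?_
    rw [pow_succ', mul_assoc]
    apply mul_le_mul_of_nonneg_left ih
    rw [sub_nonneg, div_le_one (by linarith)]
    linarith

theorem pushPull_broadcast_informs_all :
    ∃ (K : ℝ) (n₀ : ℕ), 0 < K ∧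
      ∀ n : ℕ, n₀ ≤ n →
        ∀ μ : Measure (ℕ → Fin n × Fin n), IsSchedulerMeasure n μ →
          ∀ v₀ : Fin n,
            μ {ω | informed n ω {v₀} ⌈K * n * Real.log n⌉₊ = Finset.univ} ≥
              1 - ENNReal.ofReal (K * (Real.log n) ^ 2 / n) := by
  refine ⟨3, 3, by norm_num, fun n hn μ hμ v => ?_⟩
  have hp := hμ.1
  have hn3 : (3:ℝ) ≤ n := by exact_mod_cast hn
  have hn0 : (0:ℝ) < n := by linarith
  have hlog : 1 ≤ Real.log n := by
    rw [Real.le_log_iff_exp_le hn0]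
    linarith [Real.exp_one_lt_d9]
  set T := ⌈3 * (n:ℝ) * Real.log n⌉₊ with hT
  have hTle : 3 * (n:ℝ) * Real.log n ≤ T := Nat.le_ceil _
  set A := {ω : ℕ → Fin n × Fin n | informed n ω {v} T = Finset.univ} with hA
  have hmk := mul_meas_ge_le_integral_of_nonneg (μ := μ)
    (Filter.Eventually.of_forall (fun ω => ppPot_nonneg n (informed n ω {v} T)))
    (pp_recur n (by omega) μ hμ {v} (by simp) T).1 (1 / n)
  have hb := hmk.trans (pp_bound n (by omega) μ hμ v T)
  have hsub : Aᶜ ⊆ {ω | 1 / (n:ℝ) ≤ ppPot n (informed n ω {v} T)} := by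
    intro ω hω
    have hω : informed n ω {v} T ≠ Finset.univ := hω
    have hc : (informed n ω {v} T).card < n := by
      simpa using Finset.card_lt_univ_of_notMem (Classical.choose_spec
        (not_forall.1 (mt Finset.eq_univ_iff_forall.2 hω)))
    have hc0 := (informed_nonempty' n ω {v} (by simp) T).card_pos
    have hc' : ((informed n ω {v} T).card : ℝ) + 1 ≤ n := by exact_mod_cast hc
    have hc0' : (0:ℝ) < (informed n ω {v} T).card := by exact_mod_cast hc0
    show 1 / (n:ℝ) ≤ ((n : ℝ) - _) / _
    exact div_le_div₀ (by linarith) (by linarith) hc0' (by linarith)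
  have hpow : (1 - 1 / (n:ℝ)) ^ T ≤ 1 / n ^ 3 := by
    have h0 : 0 ≤ 1 - 1 / (n:ℝ) := by
      rw [sub_nonneg, div_le_one hn0]; linarith
    calc (1 - 1 / (n:ℝ)) ^ T ≤ (Real.exp (-(1 / n))) ^ T :=
          pow_le_pow_left₀ h0 (Real.one_sub_le_exp_neg _) T
      _ = Real.exp (-(T / n)) := by rw [← Real.exp_nat_mul]; congr 1; ring
      _ ≤ Real.exp (-(3 * Real.log n)) := by
          apply Real.exp_le_exp.2
          rw [neg_le_neg_iff, le_div_iff₀ hn0]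
          linarith
      _ = 1 / n ^ 3 := by
          rw [Real.exp_neg, one_div, show (3:ℝ) * Real.log n = ((3:ℕ):ℝ) * Real.log n by norm_num,
            Real.exp_nat_mul, Real.exp_log hn0]
  have hfin : μ.real Aᶜ ≤ 3 * (Real.log n) ^ 2 / n := by
    have h1 : μ.real Aᶜ ≤ μ.real {ω | 1 / (n:ℝ) ≤ ppPot n (informed n ω {v} T)} :=
      measureReal_mono hsub
    have h2 : 1 / (n:ℝ) * μ.real Aᶜ ≤ 1 / n ^ 3 * n :=
      (mul_le_mul_of_nonneg_left h1 (by positivity)).trans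
        (hb.trans (mul_le_mul_of_nonneg_right hpow hn0.le))
    have h3 : μ.real Aᶜ ≤ 1 / n := by
      have := mul_le_mul_of_nonneg_left h2 hn0.le
      have e1 : (n:ℝ) * (1 / n * μ.real Aᶜ) = μ.real Aᶜ := by field_simp
      have e2 : (n:ℝ) * (1 / n ^ 3 * n) = 1 / n := by field_simp
      rwa [e1, e2] at this
    refine h3.trans ?_
    gcongr
    nlinarith
  have hfin' : μ Aᶜ ≤ ENNReal.ofReal (3 * (Real.log n) ^ 2 / n) := by
    rw [← ofReal_measureReal (measure_ne_top μ _)]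
    exact ENNReal.ofReal_le_ofReal hfin
  show 1 - _ ≤ μ A
  rw [tsub_le_iff_right]
  calc (1:ENNReal) = μ (A ∪ Aᶜ) := by rw [Set.union_compl_self, measure_univ]
    _ ≤ μ A + μ Aᶜ := measure_union_le _ _
    _ ≤ _ := by gcongr



end
end

section
/- There exist constants c > 0 and n₀ ∈ ℕ such that for every integer n ≥ n₀ and every initial informed set S ⊆ Fin n with |S| > n/3, within ⌈c·n·log n⌉ further steps of the push–pull broadcast all nodes become informed with probability at least 1 − 1/n: μ_n({ω : I_ω^S(⌈c·n·log n⌉) = Fin n}) ≥ 1 − 1/n. -/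
open MeasureTheory ProbabilityTheory
open scoped ENNReal

noncomputable section

theorem subset_informed (n : ℕ) (ω : ℕ → Fin n × Fin n) (S : Finset (Fin n)) (t : ℕ) :
    S ⊆ informed n ω S t := by
  induction t with
  | zero => simp [informed]
  | succ t ih =>
    intro x hx
    have := ih hx
    simp only [informed]
    split_ifs <;> simp [this]

theorem informed_mono (n : ℕ) (ω : ℕ → Fin n × Fin n) (S : Finset (Fin n)) (t k : ℕ) :
    informed n ω S t ⊆ informed n ω S (t + k) := by
  induction k with
  | zero => simp
  | succ t ih =>
    intro x hx
    have := ih hx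
    rw [← add_assoc]
    simp only [informed]
    split_ifs <;> simp [this]

theorem avoid_of_not_mem (n : ℕ) (ω : ℕ → Fin n × Fin n) (S : Finset (Fin n)) (T : ℕ)
    (v : Fin n) (hv : v ∉ informed n ω S T) (t : ℕ) (ht : t < T) :
    ω t ∈ (({v} ×ˢ S : Finset (Fin n × Fin n)) : Set (Fin n × Fin n))ᶜ := by
  intro h
  simp only [Finset.coe_product, Set.mem_prod, Finset.mem_coe, Finset.mem_singleton] at h
  apply hv
  obtain ⟨k, rfl⟩ := Nat.exists_eq_add_of_lt ht
  have h1 : v ∈ informed n ω S (t + 1) := by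
    have := subset_informed n ω S t h.2
    simp only [informed]
    rw [if_pos (Or.inr this), h.1]
    simp
  have := informed_mono n ω S (t + 1) k h1
  rwa [show t + k + 1 = t + 1 + k by ring]

theorem pairUniform_avoid (n : ℕ) (hn : 2 ≤ n) (S : Finset (Fin n)) (v : Fin n) (hv : v ∉ S)
    (hS : (n / 3 : ℝ) < (S.card : ℝ)) :
    pairUniform n (({v} ×ˢ S : Finset (Fin n × Fin n)) : Set (Fin n × Fin n))ᶜ ≤
      ENNReal.ofReal (Real.exp (-(1 / (3 * n)))) := by
  have hn0 : (0 : ℝ) < n := by positivity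
  set D : Finset (Fin n × Fin n) := Finset.univ.filter (fun p => p.1 ≠ p.2) with hD
  have hDset : {p : Fin n × Fin n | p.1 ≠ p.2} = (D : Set (Fin n × Fin n)) := by
    ext; simp [hD]
  have hBD : ({v} ×ˢ S : Finset (Fin n × Fin n)) ⊆ D := by
    rintro ⟨a, b⟩ h
    simp only [Finset.mem_product, Finset.mem_singleton] at h
    simp only [hD, Finset.mem_filter, Finset.mem_univ, true_and]
    rintro rfl
    exact hv (h.1 ▸ h.2)
  have hSpos : 0 < S.card := by
    have : (0 : ℝ) < S.card := lt_trans (by positivity) hS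
    exact_mod_cast this
  have hB : ({v} ×ˢ S : Finset (Fin n × Fin n)).card = S.card := by simp
  have hDpos : 0 < D.card := lt_of_lt_of_le (hB ▸ hSpos) (Finset.card_le_card hBD)
  have hDle : D.card ≤ n * n := by
    calc D.card ≤ _ := Finset.card_le_univ _
      _ = n * n := by simp
  unfold pairUniform
  rw [hDset, uniformOn, cond_apply D.measurableSet, Measure.count_apply_finset]
  rw [← Set.diff_eq, ← Finset.coe_sdiff, Measure.count_apply_finset, Finset.card_sdiff_of_subset hBD, hB]
  have hle : S.card ≤ D.card := hB ▸ Finset.card_le_card hBD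
  have hDp : (0 : ℝ) < D.card := by exact_mod_cast hDpos
  have : ((D.card : ℝ≥0∞))⁻¹ * ((D.card - S.card : ℕ) : ℝ≥0∞) =
      ENNReal.ofReal ((D.card : ℝ)⁻¹ * ((D.card : ℝ) - S.card)) := by
    rw [ENNReal.ofReal_mul (by positivity), ENNReal.ofReal_inv_of_pos hDp, ENNReal.ofReal_natCast,
      ← Nat.cast_sub hle, ENNReal.ofReal_natCast]
  rw [this]
  apply ENNReal.ofReal_le_ofReal
  have h1 := Real.add_one_le_exp (-(1 / (3 * (n : ℝ))))
  refine le_trans ?_ h1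
  have h2 : (D.card : ℝ) ≤ n * n := by exact_mod_cast hDle
  have h3 : 1 / (3 * (n : ℝ)) ≤ (S.card : ℝ) / D.card := by
    rw [div_le_div_iff₀ (by positivity) hDp]
    nlinarith
  have h4 : (D.card : ℝ)⁻¹ * ((D.card : ℝ) - S.card) = 1 - S.card / D.card := by
    field_simp
  linarith

/-- There exist constants `c > 0` and `n₀` such that for every `n ≥ n₀` and every initial
informed set `S` with `|S| > n/3`, within `⌈c·n·log n⌉` further steps of the push–pull
broadcast all nodes become informed with probability at least `1 − 1/n`. -/
theorem pushPull_endgame_informs_all :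
    ∃ (c : ℝ) (n₀ : ℕ), 0 < c ∧
      ∀ n : ℕ, n₀ ≤ n →
        ∀ μ : Measure (ℕ → Fin n × Fin n), IsSchedulerMeasure n μ →
          ∀ S : Finset (Fin n), (n / 3 : ℝ) < (S.card : ℝ) →
            μ {ω | informed n ω S ⌈c * n * Real.log n⌉₊ = Finset.univ} ≥
              1 - (n : ℝ≥0∞)⁻¹ := by
  refine ⟨6, 2, by norm_num, ?_⟩
  intro n hn μ hμ S hS
  obtain ⟨hP, hI, hM⟩ := hμ
  set T := ⌈(6 : ℝ) * n * Real.log n⌉₊ with hT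
  have hn0 : (0 : ℝ) < n := by positivity
  have hbad : ∀ v : Fin n, μ {ω | v ∉ informed n ω S T} ≤ ENNReal.ofReal (((n : ℝ) ^ 2)⁻¹) := by
    intro v
    by_cases hv : v ∈ S
    · have : {ω | v ∉ informed n ω S T} = ∅ := by
        ext ω
        simpa using subset_informed n ω S T hv
      rw [this]; simp
    set B : Set (Fin n × Fin n) := (({v} ×ˢ S : Finset (Fin n × Fin n)) : Set (Fin n × Fin n))ᶜ
    have hBm : MeasurableSet B := (Set.toFinite B).measurableSet
    calc μ {ω | v ∉ informed n ω S T}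
        ≤ μ (⋂ t ∈ Finset.range T, (fun ω : ℕ → Fin n × Fin n => ω t) ⁻¹' B) := by
          apply measure_mono
          intro ω hω
          simp only [Set.mem_iInter, Finset.mem_range]
          intro t ht
          exact avoid_of_not_mem n ω S T v hω t ht
      _ = ∏ t ∈ Finset.range T, μ ((fun ω : ℕ → Fin n × Fin n => ω t) ⁻¹' B) :=
          hI.measure_inter_preimage_eq_mul (Finset.range T) (sets := fun _ => B) (fun _ _ => hBm)
      _ ≤ ∏ t ∈ Finset.range T, ENNReal.ofReal (Real.exp (-(1 / (3 * n)))) := by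
          apply Finset.prod_le_prod'
          intro t _
          rw [← Measure.map_apply (measurable_pi_apply t) hBm, hM t]
          exact pairUniform_avoid n hn S v hv hS
      _ = ENNReal.ofReal (Real.exp (T * (-(1 / (3 * n))))) := by
          rw [Finset.prod_const, Finset.card_range, Real.exp_nat_mul,
            ENNReal.ofReal_pow (Real.exp_pos _).le]
      _ ≤ ENNReal.ofReal (((n : ℝ) ^ 2)⁻¹) := by
          apply ENNReal.ofReal_le_ofReal
          have h1 : (6 : ℝ) * n * Real.log n ≤ T := Nat.le_ceil _
          have h2 : ((n : ℝ) ^ 2)⁻¹ = Real.exp (-(2 * Real.log n)) := by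
            rw [Real.exp_neg, two_mul, Real.exp_add, Real.exp_log hn0, sq]
          rw [h2]
          apply Real.exp_le_exp.mpr
          have h3 : 2 * Real.log n ≤ T * (1 / (3 * n)) := by
            rw [mul_one_div, le_div_iff₀ (by positivity)]
            linarith
          linarith
  have hc : μ {ω | informed n ω S T = Finset.univ}ᶜ ≤ (n : ℝ≥0∞)⁻¹ := by
    calc μ {ω | informed n ω S T = Finset.univ}ᶜ
        ≤ μ (⋃ v : Fin n, {ω | v ∉ informed n ω S T}) := by
          apply measure_mono
          intro ω hω
          simp only [Set.mem_compl_iff, Set.mem_setOf_eq, Finset.eq_univ_iff_forall,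
            not_forall] at hω
          simpa using hω
      _ ≤ ∑ v : Fin n, μ {ω | v ∉ informed n ω S T} := measure_iUnion_fintype_le _ _
      _ ≤ ∑ v : Fin n, ENNReal.ofReal (((n : ℝ) ^ 2)⁻¹) := Finset.sum_le_sum fun v _ => hbad v
      _ = (n : ℝ≥0∞)⁻¹ := by
          rw [Finset.sum_const, Finset.card_univ, Fintype.card_fin, nsmul_eq_mul,
            ← ENNReal.ofReal_natCast, ← ENNReal.ofReal_mul hn0.le,
            ← ENNReal.ofReal_inv_of_pos hn0]
          congr 1
          field_simp
  rw [ge_iff_le, tsub_le_iff_right]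
  calc (1 : ℝ≥0∞) = μ Set.univ := measure_univ.symm
    _ = μ ({ω | informed n ω S T = Finset.univ} ∪ {ω | informed n ω S T = Finset.univ}ᶜ) := by
        rw [Set.union_compl_self]
    _ ≤ _ := measure_union_le _ _
    _ ≤ _ := by gcongr

end
end

section
/- For every real α > 0 there exist a constant c > 0 and n₀ ∈ ℕ such that for every integer n ≥ n₀, with μ_n-probability at least 1 − n^{−α}, every node v ∈ Fin n is selected for interaction at least c·log n times and at most 3c·log n times during the first ⌈c·n·log n⌉ steps; i.e., μ_n({ω : ∀ v ∈ Fin n, c·log n ≤ N_v^{⌈c·n·log n⌉}(ω) ≤ 3c·log n}) ≥ 1 − n^{−α}. -/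
open MeasureTheory ProbabilityTheory
open scoped ENNReal

noncomputable section

/-- `N_v^T(ω)`: the number of the first `T` steps in which node `v` is selected. -/
def numSelected (n : ℕ) (ω : ℕ → Fin n × Fin n) (v : Fin n) (T : ℕ) : ℕ :=
  ((Finset.range T).filter (fun t => (ω t).1 = v ∨ (ω t).2 = v)).card


lemma hit_real (n : ℕ) (hn : 2 ≤ n) (v : Fin n) :
    (pairUniform n).real {p | p.1 = v ∨ p.2 = v} = 2 / n := by
  have h1 : {p : Fin n × Fin n | p.1 ≠ p.2} = ((Finset.univ : Finset (Fin n)).offDiag : Set _) := by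
    ext p; simp
  have h2 : {p : Fin n × Fin n | p.1 ≠ p.2} ∩ {p | p.1 = v ∨ p.2 = v}
      = (((Finset.univ : Finset (Fin n)).offDiag \ (Finset.univ.erase v).offDiag : Finset _) : Set _) := by
    ext p; simp; tauto
  have h3 : ((Finset.univ.erase v).offDiag) ⊆ (Finset.univ : Finset (Fin n)).offDiag :=
    Finset.offDiag_mono (Finset.erase_subset _ _)
  have hc1 : ((Finset.univ : Finset (Fin n)).offDiag.card : ℝ) = n * (n - 1) := by
    rw [Finset.offDiag_card, Nat.cast_sub (by simp; nlinarith)]; simp; ring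
  have hc2 : ((Finset.univ.erase v).offDiag.card : ℝ) = (n - 1) * (n - 2) := by
    obtain ⟨m, rfl⟩ : ∃ m, n = m + 1 := ⟨n - 1, by omega⟩
    rw [Finset.offDiag_card, Finset.card_erase_of_mem (Finset.mem_univ _),
      Nat.cast_sub (by simp; nlinarith)]; simp; ring
  have hn' : (2 : ℝ) ≤ n := by exact_mod_cast hn
  unfold pairUniform uniformOn
  rw [measureReal_def, cond_apply (Set.toFinite _).measurableSet, h2, h1, Measure.count_apply_finset,
    Measure.count_apply_finset, Finset.card_sdiff_of_subset h3, ENNReal.toReal_mul, ENNReal.toReal_inv]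
  rw [ENNReal.toReal_natCast, ENNReal.toReal_natCast, Nat.cast_sub (Finset.card_le_card h3), hc1, hc2]
  have : (n : ℝ) - 1 ≠ 0 := by linarith
  field_simp
  ring

def hitF (n : ℕ) (v : Fin n) (p : Fin n × Fin n) : ℝ := if p.1 = v ∨ p.2 = v then 1 else 0

lemma mgf_one (n : ℕ) (hn : 2 ≤ n) (v : Fin n) (μ : Measure (ℕ → Fin n × Fin n))
    (h : IsSchedulerMeasure n μ) (t : ℕ) (s : ℝ) :
    mgf (fun ω => hitF n v (ω t)) μ s = 1 + (Real.exp s - 1) * (2 / n) := by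
  obtain ⟨hp, _, hm⟩ := h
  have hms : MeasurableSet {p : Fin n × Fin n | p.1 = v ∨ p.2 = v} := (Set.toFinite _).measurableSet
  have hmeas : Measurable (fun ω : ℕ → Fin n × Fin n => ω t) := measurable_pi_apply t
  have e : ∀ ω : ℕ → Fin n × Fin n, Real.exp (s * hitF n v (ω t)) =
      1 + (Real.exp s - 1) * ((fun ω : ℕ → Fin n × Fin n => ω t) ⁻¹' {p : Fin n × Fin n | p.1 = v ∨ p.2 = v}).indicator 1 ω := by
    intro ω
    by_cases hh : (ω t).1 = v ∨ (ω t).2 = v <;> simp [hitF, hh, Set.indicator]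
  unfold mgf
  simp_rw [e]
  rw [integral_add (integrable_const _), integral_const_mul, integral_indicator_one (hmeas hms),
    ← map_measureReal_apply hmeas hms, hm, hit_real n hn v]
  · simp
  · exact ((integrable_const (1:ℝ)).indicator (hmeas hms)).const_mul _

lemma mgf_sum_le (n : ℕ) (hn : 2 ≤ n) (v : Fin n) (μ : Measure (ℕ → Fin n × Fin n))
    (h : IsSchedulerMeasure n μ) (T : ℕ) (s : ℝ) :
    mgf (fun ω => (numSelected n ω v T : ℝ)) μ s ≤ Real.exp (T * ((Real.exp s - 1) * (2 / n))) := by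
  have e : (fun ω => (numSelected n ω v T : ℝ)) =
      ∑ t ∈ Finset.range T, (fun t (ω : ℕ → Fin n × Fin n) => hitF n v (ω t)) t := by
    ext ω; simp [numSelected, hitF, Finset.sum_apply]
  have hf : Measurable (hitF n v) := measurable_of_countable _
  have hi : iIndepFun (fun t (ω : ℕ → Fin n × Fin n) => hitF n v (ω t)) μ :=
    h.2.1.comp (fun _ => hitF n v) (fun _ => hf)
  rw [e, hi.mgf_sum (fun t => hf.comp (measurable_pi_apply t))]
  simp_rw [mgf_one n hn v μ h]
  rw [Finset.prod_const, Finset.card_range, Real.exp_nat_mul]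
  have h2 : 0 ≤ 1 + (Real.exp s - 1) * (2 / n) := by
    have := mgf_one n hn v μ h 0 s
    rw [← this]; exact mgf_nonneg
  apply pow_le_pow_left₀ h2
  rw [add_comm]; exact Real.add_one_le_exp _

lemma meas_num (n : ℕ) (v : Fin n) (T : ℕ) :
    Measurable (fun ω : ℕ → Fin n × Fin n => (numSelected n ω v T : ℝ)) := by
  have e : (fun ω => (numSelected n ω v T : ℝ)) =
      fun ω => ∑ t ∈ Finset.range T, hitF n v (ω t) := by
    ext ω; simp [numSelected, hitF]
  rw [e]
  exact Finset.measurable_sum _ fun t _ =>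
    (measurable_of_countable (hitF n v)).comp (measurable_pi_apply t)

lemma int_num (n : ℕ) (v : Fin n) (T : ℕ) (μ : Measure (ℕ → Fin n × Fin n))
    [IsProbabilityMeasure μ] (s : ℝ) :
    Integrable (fun ω => Real.exp (s * (numSelected n ω v T : ℝ))) μ := by
  apply Integrable.of_bound (C := Real.exp (|s| * T))
  · exact (Real.measurable_exp.comp ((meas_num n v T).const_mul s)).aestronglyMeasurable
  · refine Filter.Eventually.of_forall fun ω => ?_
    rw [Real.norm_eq_abs, Real.abs_exp, Real.exp_le_exp]
    have h1 : (numSelected n ω v T : ℝ) ≤ T := by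
      have := Finset.card_filter_le (Finset.range T) (fun t => (ω t).1 = v ∨ (ω t).2 = v)
      rw [Finset.card_range] at this
      exact_mod_cast this
    exact mul_le_mul (le_abs_self s) h1 (by positivity) (abs_nonneg s)

lemma log_bounds : (2 / 5 : ℝ) ≤ Real.log (3 / 2) := by
  rw [Real.le_log_iff_exp_le (by norm_num)]
  have h : Real.exp (2/5) ^ 5 = Real.exp 1 ^ 2 := by
    rw [← Real.exp_nat_mul, ← Real.exp_nat_mul]; norm_num
  by_contra hc
  push Not at hc
  have h2 := pow_lt_pow_left₀ hc (by norm_num) (n := 5) (by norm_num)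
  have := Real.exp_one_lt_d9
  have := Real.exp_pos 1
  rw [h] at h2
  nlinarith

lemma tails (n : ℕ) (hn : 2 ≤ n) (v : Fin n) (μ : Measure (ℕ → Fin n × Fin n))
    (h : IsSchedulerMeasure n μ) (c : ℝ) (hc : 0 < c) :
    μ.real {ω | ¬ (c * Real.log n ≤ (numSelected n ω v ⌈c * n * Real.log n⌉₊ : ℝ) ∧
      (numSelected n ω v ⌈c * n * Real.log n⌉₊ : ℝ) ≤ 3 * c * Real.log n)} ≤
      4 * Real.exp (- (c * Real.log n / 5)) := by
  have := h.1
  set L := Real.log n with hL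
  set T := ⌈c * n * L⌉₊ with hT
  have hn' : (2 : ℝ) ≤ n := by exact_mod_cast hn
  have hLp : 0 < L := Real.log_pos (by linarith)
  have hT1 : c * n * L ≤ T := Nat.le_ceil _
  have hT2 : (T : ℝ) < c * n * L + 1 := Nat.ceil_lt_add_one (by positivity)
  have q1 : 2 * (c * L) ≤ T * (2 / n) := by
    rw [← mul_div_assoc, le_div_iff₀ (by linarith)]; nlinarith
  have q2 : T * (2 / n) ≤ 2 * (c * L) + 1 := by
    rw [← mul_div_assoc, div_le_iff₀ (by linarith)]; nlinarith
  have hcL : 0 < c * L := by positivity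
  have l := measure_le_le_exp_mul_mgf (X := fun ω => (numSelected n ω v T : ℝ)) (μ := μ)
    (t := - Real.log 2) (c * L) (by have := Real.log_pos one_lt_two; linarith) (int_num n v T μ _)
  have u := measure_ge_le_exp_mul_mgf (X := fun ω => (numSelected n ω v T : ℝ)) (μ := μ)
    (t := Real.log (3 / 2)) (3 * c * L) (Real.log_nonneg (by norm_num)) (int_num n v T μ _)
  have ml := mgf_sum_le n hn v μ h T (- Real.log 2)
  have mu := mgf_sum_le n hn v μ h T (Real.log (3 / 2))
  rw [Real.exp_neg, Real.exp_log (by norm_num)] at ml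
  rw [Real.exp_log (by norm_num)] at mu
  have l2 : μ.real {ω | (numSelected n ω v T : ℝ) ≤ c * L} ≤ Real.exp (- (c * L / 5)) := by
    refine l.trans ((mul_le_mul_of_nonneg_left ml (Real.exp_pos _).le).trans ?_)
    rw [← Real.exp_add, Real.exp_le_exp]
    have := Real.log_two_lt_d9
    nlinarith
  have u2 : μ.real {ω | 3 * c * L ≤ (numSelected n ω v T : ℝ)} ≤ 3 * Real.exp (- (c * L / 5)) := by
    refine u.trans ((mul_le_mul_of_nonneg_left mu (Real.exp_pos _).le).trans ?_)
    have h3 : Real.exp 1 ≤ 3 := by have := Real.exp_one_lt_d9; linarith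
    refine le_trans ?_ (mul_le_mul_of_nonneg_right h3 (Real.exp_pos _).le)
    rw [← Real.exp_add, ← Real.exp_add, Real.exp_le_exp]
    have := log_bounds
    nlinarith
  have hsub : {ω | ¬ (c * L ≤ (numSelected n ω v T : ℝ) ∧ (numSelected n ω v T : ℝ) ≤ 3 * c * L)} ⊆
      {ω | (numSelected n ω v T : ℝ) ≤ c * L} ∪ {ω | 3 * c * L ≤ (numSelected n ω v T : ℝ)} := by
    intro ω hω
    simp only [Set.mem_setOf_eq, Set.mem_union, not_and_or, not_le] at hω ⊢
    exact hω.imp le_of_lt le_of_lt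
  calc _ ≤ _ := measureReal_mono hsub
    _ ≤ _ := measureReal_union_le _ _
    _ ≤ _ := by linarith

/-- For every `α > 0` there exist `c > 0` and `n₀` such that for every `n ≥ n₀`, with
probability at least `1 − n^{−α}`, every node is selected at least `c·log n` and at most
`3c·log n` times during the first `⌈c·n·log n⌉` steps. -/
theorem all_nodes_selection_counts :
    ∀ α : ℝ, 0 < α →
      ∃ (c : ℝ) (n₀ : ℕ), 0 < c ∧
        ∀ n : ℕ, n₀ ≤ n →
          ∀ μ : Measure (ℕ → Fin n × Fin n), IsSchedulerMeasure n μ →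
            μ {ω | ∀ v : Fin n,
                  c * Real.log n ≤ (numSelected n ω v ⌈c * n * Real.log n⌉₊ : ℝ) ∧
                  (numSelected n ω v ⌈c * n * Real.log n⌉₊ : ℝ) ≤ 3 * c * Real.log n} ≥
              1 - ENNReal.ofReal ((n : ℝ) ^ (-α)) := by
  intro α hα
  refine ⟨5 * (α + 2), 4, by positivity, ?_⟩
  intro n hn μ h
  have := h.1
  set c := 5 * (α + 2) with hc
  have hn' : (4 : ℝ) ≤ n := by exact_mod_cast hn
  set S : Fin n → Set (ℕ → Fin n × Fin n) := fun v =>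
    {ω | ¬ (c * Real.log n ≤ (numSelected n ω v ⌈c * n * Real.log n⌉₊ : ℝ) ∧
      (numSelected n ω v ⌈c * n * Real.log n⌉₊ : ℝ) ≤ 3 * c * Real.log n)} with hS
  have hb : μ.real (⋃ v, S v) ≤ (n : ℝ) ^ (-α) := by
    calc μ.real (⋃ v, S v) ≤ ∑ v, μ.real (S v) := measureReal_iUnion_fintype_le _
      _ ≤ ∑ v : Fin n, 4 * Real.exp (- (c * Real.log n / 5)) :=
        Finset.sum_le_sum fun v _ => tails n (by omega) v μ h c (by positivity)
      _ = n * (4 * (n : ℝ) ^ (-α - 2)) := by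
        rw [Finset.sum_const, Finset.card_univ, Fintype.card_fin, nsmul_eq_mul,
          Real.rpow_def_of_pos (by linarith)]
        congr 3; rw [hc]; ring
      _ ≤ (n : ℝ) ^ (-α) := by
        rw [Real.rpow_sub (by linarith)]
        have := Real.rpow_pos_of_pos (show (0:ℝ) < n by linarith) (-α)
        norm_num
        field_simp
        linarith
  have hset : {ω | ∀ v : Fin n,
      c * Real.log n ≤ (numSelected n ω v ⌈c * n * Real.log n⌉₊ : ℝ) ∧
      (numSelected n ω v ⌈c * n * Real.log n⌉₊ : ℝ) ≤ 3 * c * Real.log n} = (⋃ v, S v)ᶜ := by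
    ext ω; simp [hS]
  rw [hset]
  have hm : μ (⋃ v, S v) ≤ ENNReal.ofReal ((n : ℝ) ^ (-α)) := by
    rw [← ofReal_measureReal]; exact ENNReal.ofReal_le_ofReal hb
  have h1 : (1 : ℝ≥0∞) ≤ μ (⋃ v, S v) + μ (⋃ v, S v)ᶜ := by
    rw [← measure_univ (μ := μ), ← Set.union_compl_self (⋃ v, S v)]
    exact measure_union_le _ _
  rw [ge_iff_le, tsub_le_iff_left]
  exact h1.trans (by gcongr)

end
end

section
/- There exist constants c > 0, K > 0 and n₀ ∈ ℕ such that for every integer n ≥ n₀ and every node v ∈ Fin n, with μ_n-probability at least 1 − K·(log n)²/n the node v interacts with at least c·log n distinct other nodes during the first ⌈2c·n·log n⌉ steps; i.e., μ_n({ω : |{u ∈ Fin n : u ≠ v and ∃ t < ⌈2c·n·log n⌉ with {ω(t).1, ω(t).2} = {v, u}}| ≥ c·log n}) ≥ 1 − K·(log n)²/n. -/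
open MeasureTheory ProbabilityTheory
open scoped ENNReal

noncomputable section

/-- new partner set of `v` in a step selecting `y`. -/
def newP {n : ℕ} (v : Fin n) (y : Fin n × Fin n) : Finset (Fin n) :=
  Finset.univ.filter (fun u => u ≠ v ∧ ({y.1, y.2} : Finset (Fin n)) = {v, u})

/-- partner set of `v` after `t` steps. -/
def partS {n : ℕ} (v : Fin n) : ℕ → (ℕ → Fin n × Fin n) → Finset (Fin n)
  | 0, _ => ∅
  | t + 1, ω => partS v t ω ∪ newP v (ω t)

lemma mem_partS {n : ℕ} (v : Fin n) (t : ℕ) (ω : ℕ → Fin n × Fin n) (u : Fin n) :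
    u ∈ partS v t ω ↔ (u ≠ v ∧ ∃ i, i < t ∧ ({(ω i).1, (ω i).2} : Finset (Fin n)) = {v, u}) := by
  induction t with
  | zero => simp [partS]
  | succ t ih =>
    simp only [partS, Finset.mem_union, ih, newP, Finset.mem_filter, Finset.mem_univ, true_and]
    constructor
    · rintro (⟨h, i, hi, e⟩ | ⟨h, e⟩)
      · exact ⟨h, i, by omega, e⟩
      · exact ⟨h, t, by omega, e⟩
    · rintro ⟨h, i, hi, e⟩
      rcases Nat.lt_succ_iff_lt_or_eq.1 hi with hi | rfl
      · exact Or.inl ⟨h, i, hi, e⟩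
      · exact Or.inr ⟨h, e⟩

lemma partS_congr {n : ℕ} (v : Fin n) (t : ℕ) (ω ω' : ℕ → Fin n × Fin n)
    (h : ∀ i < t, ω i = ω' i) : partS v t ω = partS v t ω' := by
  induction t with
  | zero => rfl
  | succ t ih =>
    simp only [partS]
    rw [ih (fun i hi => h i (by omega)), h t (by omega)]

/-- potential -/
def pot {n : ℕ} (L : ℝ) (S : Finset (Fin n)) : ℝ≥0∞ :=
  if (S.card : ℝ) < L then (2⁻¹ : ℝ≥0∞) ^ S.card else 0

lemma indep_partS {n : ℕ} {μ : Measure (ℕ → Fin n × Fin n)} (hμ : IsSchedulerMeasure n μ)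
    (v : Fin n) (t : ℕ) : IndepFun (partS v t) (fun ω => ω t) μ := by
  obtain ⟨hp, hi, -⟩ := hμ
  have h := hi.indepFun_finset (Finset.range t) {t} (by simp) (fun i => measurable_pi_apply i)
  have h2 := h.comp
    (φ := fun a => partS v t (fun i => if h : i ∈ Finset.range t then a ⟨i, h⟩ else (v, v)))
    (ψ := fun a => a ⟨t, by simp⟩) (Measurable.of_discrete) (Measurable.of_discrete)
  refine h2.congr (Filter.Eventually.of_forall fun ω => ?_) (Filter.Eventually.of_forall fun ω => rfl)
  symm
  apply partS_congr
  intro i hi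
  simp [hi]

lemma pot_union_le {n : ℕ} (L : ℝ) (S N : Finset (Fin n)) (A : Prop) [Decidable A]
    (h : A → ∃ u ∈ N, u ∉ S) :
    pot L (S ∪ N) ≤ pot L S * (if A then 2⁻¹ else 1) := by
  have hm : S.card ≤ (S ∪ N).card := Finset.card_le_card Finset.subset_union_left
  unfold pot
  by_cases h1 : ((S ∪ N).card : ℝ) < L
  · have h2 : (S.card : ℝ) < L := lt_of_le_of_lt (by exact_mod_cast hm) h1
    rw [if_pos h1, if_pos h2]
    have h12 : (2⁻¹ : ℝ≥0∞) ≤ 1 := by simp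
    split_ifs with hA
    · obtain ⟨u, hu, hu'⟩ := h hA
      have : S.card < (S ∪ N).card := Finset.card_lt_card
        ⟨Finset.subset_union_left, fun hh => hu' (hh (Finset.mem_union_right _ hu))⟩
      rw [← pow_succ]
      exact pow_le_pow_right_of_le_one' h12 this
    · rw [mul_one]
      exact pow_le_pow_right_of_le_one' h12 hm
  · rw [if_neg h1]; exact zero_le

lemma inner_bound {n : ℕ} (hn : 2 ≤ n) (v : Fin n) (L : ℝ) (hL : 1 + L ≤ n / 4)
    (S : Finset (Fin n)) :
    ∫⁻ y, pot L (S ∪ newP v y) ∂(pairUniform n) ≤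
      ENNReal.ofReal (1 - 3 / (8 * n)) * pot L S := by
  classical
  have hn0 : (0 : ℝ) < n := by positivity
  by_cases hS : (S.card : ℝ) < L
  swap
  · have : ∀ y, pot L (S ∪ newP v y) ≤ 0 := fun y => by
      have := pot_union_le L S (newP v y) False (by simp)
      simpa [pot, hS] using this
    calc _ ≤ ∫⁻ y, 0 ∂(pairUniform n) := lintegral_mono this
      _ ≤ _ := by simp
  set A : Finset (Fin n × Fin n) := (insert v S)ᶜ.image (fun u => (v, u)) with hA
  have hAcard : (3 / 4 * n : ℝ) ≤ A.card := by
    rw [hA, Finset.card_image_of_injective _ (fun a b h => (Prod.ext_iff.1 h).2)]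
    have h1 := Finset.card_compl_add_card (insert v S)
    have h2 := Finset.card_insert_le v S
    rw [Fintype.card_fin] at h1
    have h3 : n ≤ (insert v S)ᶜ.card + (S.card + 1) := by omega
    have h4 : (n : ℝ) ≤ (insert v S)ᶜ.card + (S.card + 1) := by exact_mod_cast h3
    linarith
  have : IsProbabilityMeasure (pairUniform n) := by
    apply isProbabilityMeasure_uniformOn (Set.toFinite _)
    exact ⟨(⟨0, by omega⟩, ⟨1, by omega⟩), by simp⟩
  have hν : (3 / (4 * n) : ℝ) ≤ (pairUniform n).real A := by
    have e : {p : Fin n × Fin n | p.1 ≠ p.2} =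
      ((Finset.univ.filter (fun p : Fin n × Fin n => p.1 ≠ p.2) : Finset _) : Set _) := by
      ext; simp
    rw [Measure.real, pairUniform, e, uniformOn_apply_finset]
    set B := Finset.univ.filter (fun p : Fin n × Fin n => p.1 ≠ p.2) with hB
    have hAB : B ∩ A = A := by
      apply Finset.inter_eq_right.2
      intro p hp
      simp only [hA, Finset.mem_image, Finset.mem_compl, Finset.mem_insert, not_or] at hp
      obtain ⟨u, ⟨hu, -⟩, rfl⟩ := hp
      simpa [hB] using fun h => hu h.symm
    have hBc : (B.card : ℝ) ≤ n * n := by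
      have := Finset.card_le_univ B
      simp at this
      exact_mod_cast this
    have hAle : (A.card : ℝ) ≤ B.card := by
      exact_mod_cast Finset.card_le_card (Finset.inter_eq_right.1 hAB)
    rw [hAB, ENNReal.toReal_div, ENNReal.toReal_natCast, ENNReal.toReal_natCast]
    have hBpos : (0 : ℝ) < B.card := by nlinarith
    rw [div_le_div_iff₀ (by positivity) hBpos]
    nlinarith
  have hstep : ∀ y, pot L (S ∪ newP v y) ≤
      pot L S * (if y ∈ A then 2⁻¹ else 1) := fun y => by
    apply pot_union_le
    intro hy
    simp only [hA, Finset.mem_image, Finset.mem_compl, Finset.mem_insert, not_or] at hy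
    obtain ⟨u, ⟨hu, hu'⟩, rfl⟩ := hy
    exact ⟨u, by simp [newP, hu], hu'⟩
  calc ∫⁻ y, pot L (S ∪ newP v y) ∂(pairUniform n)
      ≤ ∫⁻ y, pot L S * (if y ∈ A then 2⁻¹ else 1) ∂(pairUniform n) := lintegral_mono hstep
    _ = pot L S * ∫⁻ y, (if y ∈ A then 2⁻¹ else 1) ∂(pairUniform n) :=
        lintegral_const_mul _ Measurable.of_discrete
    _ = pot L S * (2⁻¹ * (pairUniform n) A + (pairUniform n) (A : Set _)ᶜ) := by
        congr 1
        have : (fun y => if y ∈ A then (2⁻¹ : ℝ≥0∞) else 1) = fun y =>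
          (A : Set _).indicator (fun _ => (2⁻¹ : ℝ≥0∞)) y +
          ((A : Set (Fin n × Fin n))ᶜ).indicator (fun _ => (1 : ℝ≥0∞)) y := by
          funext y
          by_cases hy : y ∈ A <;> simp [hy]
        rw [this, lintegral_add_left Measurable.of_discrete,
          lintegral_indicator_const (MeasurableSet.of_discrete),
          lintegral_indicator_const (MeasurableSet.of_discrete), one_mul]
    _ ≤ pot L S * ENNReal.ofReal (1 - 3 / (8 * n)) := by
        gcongr
        have h2 : (2⁻¹ : ℝ≥0∞) = ENNReal.ofReal (1 / 2) := by
          rw [one_div, ENNReal.ofReal_inv_of_pos (by norm_num)]; simp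
        rw [← ofReal_measureReal, ← ofReal_measureReal, h2,
          ← ENNReal.ofReal_mul (by norm_num), ← ENNReal.ofReal_add (by positivity) (by positivity),
          probReal_compl_eq_one_sub MeasurableSet.of_discrete]
        apply ENNReal.ofReal_le_ofReal
        have : (3 / (8 * n) : ℝ) = 1 / 2 * (3 / (4 * n)) := by field_simp; norm_num
        rw [this]
        linarith
    _ = _ := mul_comm _ _

lemma partS_meas {n : ℕ} (v : Fin n) (t : ℕ) : Measurable (partS v t) := by
  induction t with
  | zero => exact measurable_const
  | succ t ih =>
    have h1 : Measurable (fun p : Finset (Fin n) × (Fin n × Fin n) => p.1 ∪ newP v p.2) :=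
      Measurable.of_discrete
    have h2 : Measurable (fun ω : ℕ → Fin n × Fin n => (partS v t ω, ω t)) :=
      ih.prodMk (measurable_pi_apply t)
    have e : partS v (t + 1) = fun ω => partS v t ω ∪ newP v (ω t) := by
      funext ω; rfl
    rw [e]
    have h3 := h1.comp h2
    simp only [Function.comp_def] at h3
    exact h3

lemma pot_bound {n : ℕ} (hn : 2 ≤ n) {μ : Measure (ℕ → Fin n × Fin n)}
    (hμ : IsSchedulerMeasure n μ) (v : Fin n) (L : ℝ) (hL : 1 + L ≤ n / 4) (t : ℕ) :
    ∫⁻ ω, pot L (partS v t ω) ∂μ ≤ ENNReal.ofReal (1 - 3 / (8 * n)) ^ t := by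
  have hp := hμ.1
  have hm : ∀ t, Measurable (partS v t) := partS_meas v
  induction t with
  | zero =>
    calc _ ≤ ∫⁻ ω, 1 ∂μ := lintegral_mono fun ω => by
          unfold pot; split_ifs <;> simp [partS]
      _ ≤ _ := by simp
  | succ t ih =>
    have hmap := (indepFun_iff_map_prod_eq_prod_map_map (hm t).aemeasurable
      (measurable_pi_apply t).aemeasurable).1 (indep_partS hμ v t)
    rw [hμ.2.2 t] at hmap
    have : SFinite (pairUniform n) := by rw [← hμ.2.2 t]; infer_instance
    calc ∫⁻ ω, pot L (partS v (t + 1) ω) ∂μ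
        = ∫⁻ p : Finset (Fin n) × (Fin n × Fin n), pot L (p.1 ∪ newP v p.2)
            ∂(μ.map (fun ω => (partS v t ω, ω t))) := by
          rw [lintegral_map Measurable.of_discrete ((hm t).prodMk (measurable_pi_apply t))]
          rfl
      _ = ∫⁻ S, ∫⁻ y, pot L (S ∪ newP v y) ∂(pairUniform n) ∂(μ.map (partS v t)) := by
          rw [hmap, lintegral_prod _ Measurable.of_discrete.aemeasurable]
      _ ≤ ∫⁻ S, ENNReal.ofReal (1 - 3 / (8 * n)) * pot L S ∂(μ.map (partS v t)) :=
          lintegral_mono fun S => inner_bound hn v L hL S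
      _ = ENNReal.ofReal (1 - 3 / (8 * n)) * ∫⁻ ω, pot L (partS v t ω) ∂μ := by
          rw [lintegral_const_mul _ Measurable.of_discrete,
            lintegral_map Measurable.of_discrete (hm t)]
      _ ≤ _ := by
          rw [pow_succ, mul_comm]
          gcongr

lemma tail_bound {n : ℕ} (hn : 2 ≤ n) {μ : Measure (ℕ → Fin n × Fin n)}
    (hμ : IsSchedulerMeasure n μ) (v : Fin n) (L : ℝ) (hL : 1 + L ≤ n / 4) (t : ℕ) :
    μ {ω | ((partS v t ω).card : ℝ) < L} ≤
      ENNReal.ofReal ((2 : ℝ) ^ L * (1 - 3 / (8 * n)) ^ t) := by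
  have hn1 : (2 : ℝ) ≤ n := by exact_mod_cast hn
  have hq : (0 : ℝ) ≤ 1 - 3 / (8 * n) := by
    rw [sub_nonneg, div_le_one (by positivity)]; linarith
  have h1 : ENNReal.ofReal ((2 : ℝ) ^ (-L)) * μ {ω | ((partS v t ω).card : ℝ) < L} ≤
      ENNReal.ofReal (1 - 3 / (8 * n)) ^ t := by
    refine le_trans ?_ (pot_bound hn hμ v L hL t)
    refine le_trans ?_ (mul_meas_ge_le_lintegral₀ (f := fun ω => pot L (partS v t ω)) ?_
      (ENNReal.ofReal ((2 : ℝ) ^ (-L))))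
    · refine mul_le_mul_right (measure_mono fun ω hω => ?_) _
      have hω' : ((partS v t ω).card : ℝ) < L := hω
      have h2 : (2⁻¹ : ℝ≥0∞) = ENNReal.ofReal (2⁻¹) := by
        rw [ENNReal.ofReal_inv_of_pos (by norm_num)]; simp
      change ENNReal.ofReal ((2 : ℝ) ^ (-L)) ≤ pot L (partS v t ω)
      rw [pot, if_pos hω']
      rw [h2, ← ENNReal.ofReal_pow (by norm_num)]
      apply ENNReal.ofReal_le_ofReal
      rw [inv_pow, ← Real.rpow_natCast, ← Real.rpow_neg (by norm_num)]
      apply Real.rpow_le_rpow_of_exponent_le (by norm_num)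
      linarith
    · exact ((Measurable.of_discrete (f := fun S : Finset (Fin n) => pot L S)).comp (partS_meas v t)).aemeasurable
  have h3 : (1 : ℝ≥0∞) = ENNReal.ofReal ((2 : ℝ) ^ L) * ENNReal.ofReal ((2 : ℝ) ^ (-L)) := by
    rw [← ENNReal.ofReal_mul (by positivity), ← Real.rpow_add (by norm_num)]; simp
  calc _ = ENNReal.ofReal ((2 : ℝ) ^ L) * (ENNReal.ofReal ((2 : ℝ) ^ (-L)) *
        μ {ω | ((partS v t ω).card : ℝ) < L}) := by rw [← mul_assoc, ← h3, one_mul]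
    _ ≤ ENNReal.ofReal ((2 : ℝ) ^ L) * ENNReal.ofReal (1 - 3 / (8 * n)) ^ t := by gcongr
    _ = _ := by rw [← ENNReal.ofReal_pow hq, ← ENNReal.ofReal_mul (by positivity)]

lemma num_bound {n t : ℕ} (hn : 3 ≤ n) (ht : 2 * 20 * n * Real.log n ≤ t) :
    (2 : ℝ) ^ (20 * Real.log n) * (1 - 3 / (8 * n)) ^ t ≤ 1 * (Real.log n) ^ 2 / n := by
  have hn1 : (3 : ℝ) ≤ n := by exact_mod_cast hn
  have hlog : 1 ≤ Real.log n := by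
    rw [Real.le_log_iff_exp_le (by linarith)]
    linarith [Real.exp_one_lt_d9]
  have hq : (0 : ℝ) ≤ 1 - 3 / (8 * n) := by
    rw [sub_nonneg, div_le_one (by positivity)]; linarith
  have h1 : (1 - 3 / (8 * n) : ℝ) ^ t ≤ Real.exp (-(15 * Real.log n)) := by
    calc (1 - 3 / (8 * n) : ℝ) ^ t ≤ (Real.exp (-(3 / (8 * n)))) ^ t := by
          gcongr
          exact Real.one_sub_le_exp_neg _
      _ = Real.exp (t * (-(3 / (8 * n)))) := by rw [← Real.exp_nat_mul]
      _ ≤ _ := by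
          apply Real.exp_le_exp.2
          have : (2 * 20 * n * Real.log n) * (3 / (8 * n)) ≤ t * (3 / (8 * n)) := by gcongr
          have e : (2 * 20 * n * Real.log n) * (3 / (8 * n)) = 15 * Real.log n := by
            field_simp; norm_num
          linarith
  rw [Real.rpow_def_of_pos (by norm_num)]
  calc _ ≤ Real.exp (Real.log 2 * (20 * Real.log n)) * Real.exp (-(15 * Real.log n)) := by gcongr
    _ = Real.exp (Real.log 2 * (20 * Real.log n) + -(15 * Real.log n)) := (Real.exp_add _ _).symm
    _ ≤ Real.exp (-Real.log n) := by
        apply Real.exp_le_exp.2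
        nlinarith [Real.log_two_lt_d9]
    _ = 1 / n := by rw [Real.exp_neg, Real.exp_log (by linarith), one_div]
    _ ≤ _ := by
        gcongr
        nlinarith

/-- There exist constants `c > 0`, `K > 0` and `n₀` such that for every `n ≥ n₀` and every
node `v`, with probability at least `1 − K·(log n)²/n` the node `v` interacts with at least
`c·log n` distinct other nodes during the first `⌈2c·n·log n⌉` steps. -/
theorem many_distinct_interaction_partners :
    ∃ (c K : ℝ) (n₀ : ℕ), 0 < c ∧ 0 < K ∧
      ∀ n : ℕ, n₀ ≤ n →
        ∀ μ : Measure (ℕ → Fin n × Fin n), IsSchedulerMeasure n μ →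
          ∀ v : Fin n,
            μ {ω | c * Real.log n ≤
                (({u : Fin n | u ≠ v ∧ ∃ t, t < ⌈2 * c * n * Real.log n⌉₊ ∧
                    ({(ω t).1, (ω t).2} : Finset (Fin n)) = {v, u}}).ncard : ℝ)} ≥
              1 - ENNReal.ofReal (K * (Real.log n) ^ 2 / n) := by
  have hev : ∀ᶠ n : ℕ in Filter.atTop, 1 + 20 * Real.log n ≤ (n : ℝ) / 4 := by
    have h1 : ∀ᶠ x : ℝ in Filter.atTop, ‖Real.log x‖ ≤ (1 / 160) * ‖x‖ :=
      Real.isLittleO_log_id_atTop.bound (by norm_num)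
    have h2 : ∀ᶠ x : ℝ in Filter.atTop, (8 : ℝ) ≤ x := Filter.eventually_ge_atTop 8
    have h3 : ∀ᶠ x : ℝ in Filter.atTop, 1 + 20 * Real.log x ≤ x / 4 := by
      filter_upwards [h1, h2] with x hx hx2
      rw [Real.norm_eq_abs, Real.norm_eq_abs, abs_of_nonneg (by linarith : 0 ≤ x)] at hx
      linarith [le_abs_self (Real.log x)]
    exact tendsto_natCast_atTop_atTop.eventually h3
  obtain ⟨n₁, hn₁⟩ := Filter.eventually_atTop.1 hev
  refine ⟨20, 1, max n₁ 3, by norm_num, by norm_num, ?_⟩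
  intro n hn μ hμ v
  have hn3 : 3 ≤ n := le_trans (le_max_right _ _) hn
  have hL := hn₁ n (le_trans (le_max_left _ _) hn)
  have hp := hμ.1
  set T := ⌈2 * 20 * (n : ℝ) * Real.log n⌉₊ with hT
  have hset : ∀ ω : ℕ → Fin n × Fin n, ({u : Fin n | u ≠ v ∧ ∃ t, t < T ∧
      ({(ω t).1, (ω t).2} : Finset (Fin n)) = {v, u}}).ncard = (partS v T ω).card := by
    intro ω
    rw [← Set.ncard_coe_finset]
    congr 1
    ext u
    simp only [Finset.mem_coe, mem_partS, Set.mem_ofPred_eq]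
  simp only [hset]
  have hb := tail_bound (by omega) hμ v _ hL T
  have hc : {ω | 20 * Real.log n ≤ ((partS v T ω).card : ℝ)} =
      {ω | ((partS v T ω).card : ℝ) < 20 * Real.log n}ᶜ := by
    ext ω; simp
  have hms : MeasurableSet {ω | ((partS v T ω).card : ℝ) < 20 * Real.log n} :=
    (partS_meas v T) (MeasurableSet.of_discrete
      (s := {S : Finset (Fin n) | (S.card : ℝ) < 20 * Real.log n}))
  rw [hc, prob_compl_eq_one_sub hms]
  apply tsub_le_tsub_left
  refine hb.trans (ENNReal.ofReal_le_ofReal ?_)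
  exact num_bound hn3 (Nat.le_ceil _)

end
end

section
/- For every real p with 0 < p < 1 there exist a constant C > 0, a real q with 0 < q < 1, and n₀ ∈ ℕ such that for all integers n ≥ n₀: if X₁,…,Xₙ are i.i.d. Binomial(⌈C·log n⌉, p) random variables, then with probability at least q the maximum is attained at exactly one index, i.e., P(there is exactly one i ∈ {1,…,n} with X_i = max_{1 ≤ j ≤ n} X_j) ≥ q. -/
open MeasureTheory ProbabilityTheory
open scoped ENNReal

noncomputable section

/-- The `Binomial(m,p)` point probability `P(k) = C(m,k)·p^k·(1−p)^{m−k}`. -/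
def binomPMF (m : ℕ) (p : ℝ) (k : ℕ) : ℝ :=
  (m.choose k : ℝ) * p ^ k * (1 - p) ^ (m - k)

/-- `X` is a family of i.i.d. `Binomial(m,p)` random variables on `(Ω, μ)`: the `X i` are
mutually independent and each has the binomial point probabilities. -/
def IsIIDBinomial {Ω : Type*} [MeasurableSpace Ω] {ι : Type*} (μ : Measure Ω)
    (X : ι → Ω → ℕ) (m : ℕ) (p : ℝ) : Prop :=
  iIndepFun X μ ∧
  ∀ (i : ι) (k : ℕ), μ {ω | X i ω = k} = ENNReal.ofReal (binomPMF m p k)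

lemma aux_num (p : ℝ) (hp0 : 0 < p) (hp1 : p < 1) (n : ℕ) (hn : 2 ≤ n) (m : ℕ)
    (hm : m = ⌈(-Real.log p)⁻¹ * Real.log n⌉₊) :
    p * Real.exp (-1) ≤ n * (p ^ m * (1 - p ^ m) ^ (n - 1)) := by
  have hl : 0 < -Real.log p := by have := Real.log_neg hp0 hp1; linarith
  have hn0 : (0 : ℝ) < n := by positivity
  have hn1 : (1 : ℝ) ≤ n := by exact_mod_cast (by omega : 1 ≤ n)
  have hln : 0 ≤ Real.log n := Real.log_nonneg hn1
  have h1 : (-Real.log p)⁻¹ * Real.log n ≤ m := hm ▸ Nat.le_ceil _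
  have h2 : (m : ℝ) < (-Real.log p)⁻¹ * Real.log n + 1 :=
    hm ▸ Nat.ceil_lt_add_one (by positivity)
  have e1 : Real.log n ≤ m * (-Real.log p) := by
    rw [inv_mul_le_iff₀ hl] at h1; linarith
  have e2 : m * (-Real.log p) ≤ Real.log n + (-Real.log p) := by
    have := mul_le_mul_of_nonneg_right h2.le hl.le
    have h3 : ((-Real.log p)⁻¹ * Real.log n + 1) * (-Real.log p) = Real.log n + (-Real.log p) := by
      rw [add_mul, one_mul, mul_comm _ (Real.log n), mul_assoc, inv_mul_cancel₀ hl.ne', mul_one]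
    linarith
  have hpm : p ^ m = Real.exp (m * Real.log p) := by
    rw [mul_comm, ← Real.rpow_def_of_pos hp0, Real.rpow_natCast]
  have t1 : p ^ m ≤ 1 / n := by
    rw [hpm]
    calc Real.exp (m * Real.log p) ≤ Real.exp (-Real.log n) := Real.exp_le_exp.2 (by linarith)
      _ = 1 / n := by rw [Real.exp_neg, Real.exp_log hn0, one_div]
  have t2 : p ≤ n * p ^ m := by
    rw [hpm]
    calc p = Real.exp (Real.log p) := (Real.exp_log hp0).symm
      _ ≤ Real.exp (Real.log n + m * Real.log p) := Real.exp_le_exp.2 (by linarith)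
      _ = _ := by rw [Real.exp_add, Real.exp_log hn0]
  have t3 : Real.exp (-1) ≤ (1 - p ^ m) ^ (n - 1) := by
    obtain ⟨k, rfl⟩ : ∃ k, n = k + 1 := ⟨n - 1, by omega⟩
    have hk : (0 : ℝ) < k := by exact_mod_cast (by omega : 0 < k)
    have h5 : Real.exp (-(1 / k : ℝ)) ≤ 1 - p ^ m := by
      calc Real.exp (-(1 / k : ℝ)) = (Real.exp (1 / k : ℝ))⁻¹ := Real.exp_neg _
        _ ≤ (1 / k + 1 : ℝ)⁻¹ := by
            apply inv_anti₀ (by positivity) (Real.add_one_le_exp _)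
        _ = 1 - 1 / (k + 1 : ℝ) := by field_simp; ring
        _ ≤ _ := by push_cast at t1; linarith
    calc Real.exp (-1) = Real.exp (-(1 / k : ℝ)) ^ k := by
          rw [← Real.exp_nat_mul]; congr 1; field_simp
      _ ≤ _ := by
          simpa using pow_le_pow_left₀ (Real.exp_pos _).le h5 k
  calc p * Real.exp (-1) ≤ (n * p ^ m) * (1 - p ^ m) ^ (n - 1) :=
        mul_le_mul t2 t3 (Real.exp_pos _).le (by positivity)
    _ = _ := by ring

lemma aux_null {Ω : Type} [MeasurableSpace Ω] (μ : Measure Ω) [IsProbabilityMeasure μ]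
    (A : Set Ω) (h : μ A + μ Aᶜ ≤ 1) : NullMeasurableSet A μ := by
  have hi := measure_union_add_inter (μ := μ) (toMeasurable μ A) (measurableSet_toMeasurable μ Aᶜ)
  have hu : toMeasurable μ A ∪ toMeasurable μ Aᶜ = Set.univ := by
    apply Set.eq_univ_of_univ_subset
    rw [← Set.union_compl_self A]
    exact Set.union_subset_union (subset_toMeasurable _ _) (subset_toMeasurable _ _)
  rw [hu, measure_univ, measure_toMeasurable, measure_toMeasurable] at hi
  have h0 : μ (toMeasurable μ A ∩ toMeasurable μ Aᶜ) = 0 := by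
    have h3 : 1 + μ (toMeasurable μ A ∩ toMeasurable μ Aᶜ) ≤ 1 + 0 := by rw [hi]; simpa using h
    exact le_antisymm ((ENNReal.add_le_add_iff_left ENNReal.one_ne_top).1 h3) zero_le
  refine ⟨toMeasurable μ A, measurableSet_toMeasurable _ _, ?_⟩
  refine (ae_eq_set.2 ⟨?_, ?_⟩)
  · rw [Set.diff_eq_empty.2 (subset_toMeasurable _ _)]; simp
  · refine measure_mono_null ?_ h0
    rintro x ⟨hx, hx'⟩
    exact ⟨hx, subset_toMeasurable _ _ hx'⟩

lemma aux_one {Ω : Type} [MeasurableSpace Ω] (μ : Measure Ω) [IsProbabilityMeasure μ]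
    (p : ℝ) (hp0 : 0 < p) (hp1 : p < 1) (m : ℕ) (Y : Ω → ℕ)
    (h : ∀ k, μ {ω | Y ω = k} = ENNReal.ofReal (binomPMF m p k)) :
    μ {ω | m < Y ω} = 0 ∧ μ (Y ⁻¹' {m}) = ENNReal.ofReal (p ^ m) ∧
    μ (Y ⁻¹' {m}ᶜ) = ENNReal.ofReal (1 - p ^ m) ∧ NullMeasurableSet (Y ⁻¹' {m}) μ := by
  have hq : 0 < 1 - p := by linarith
  have hnn : ∀ k, 0 ≤ binomPMF m p k := fun k => by unfold binomPMF; positivity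
  have hgt : μ {ω | m < Y ω} = 0 := by
    have : {ω | m < Y ω} ⊆ ⋃ k : ℕ, {ω | Y ω = m + 1 + k} := by
      intro ω hω
      simp only [Set.mem_iUnion, Set.mem_setOf_eq] at hω ⊢
      exact ⟨Y ω - (m + 1), by omega⟩
    refine measure_mono_null this (measure_iUnion_null fun k => ?_)
    rw [h]
    simp [binomPMF, Nat.choose_eq_zero_of_lt (show m < m + 1 + k by omega)]
  have hE : μ (Y ⁻¹' {m}) = ENNReal.ofReal (p ^ m) := by
    have := h m
    simpa [binomPMF, Set.preimage] using this
  have hsum : ∑ k ∈ Finset.range m, binomPMF m p k = 1 - p ^ m := by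
    have h1 := add_pow p (1 - p) m
    rw [Finset.sum_range_succ] at h1
    simp only [add_sub_cancel, one_pow, Nat.sub_self, pow_zero, Nat.choose_self, mul_one,
      Nat.cast_one] at h1
    have : ∑ k ∈ Finset.range m, binomPMF m p k =
      ∑ k ∈ Finset.range m, p ^ k * (1 - p) ^ (m - k) * (m.choose k : ℝ) :=
      Finset.sum_congr rfl fun k _ => by unfold binomPMF; ring
    linarith
  have hle : μ (Y ⁻¹' {m}ᶜ) ≤ ENNReal.ofReal (1 - p ^ m) := by
    have : Y ⁻¹' {m}ᶜ ⊆ (⋃ k ∈ Finset.range m, {ω | Y ω = k}) ∪ {ω | m < Y ω} := by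
      intro ω hω
      simp at hω ⊢
      omega
    calc μ (Y ⁻¹' {m}ᶜ) ≤ _ := measure_mono this
      _ ≤ _ := measure_union_le _ _
      _ = μ (⋃ k ∈ Finset.range m, {ω | Y ω = k}) := by rw [hgt, add_zero]
      _ ≤ ∑ k ∈ Finset.range m, μ {ω | Y ω = k} := measure_biUnion_finset_le _ _
      _ = ENNReal.ofReal (1 - p ^ m) := by
        simp_rw [h]
        rw [← hsum, ENNReal.ofReal_sum_of_nonneg fun k _ => hnn k]
  have ht0 : 0 ≤ p ^ m := by positivity
  have ht1 : p ^ m ≤ 1 := pow_le_one₀ hp0.le hp1.le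
  have hs : ENNReal.ofReal (p ^ m) + ENNReal.ofReal (1 - p ^ m) = 1 := by
    rw [← ENNReal.ofReal_add ht0 (by linarith)]; simp
  have hN : NullMeasurableSet (Y ⁻¹' {m}) μ := by
    apply aux_null
    rw [← hs, hE, ← Set.preimage_compl]
    gcongr
  refine ⟨hgt, hE, ?_, hN⟩
  have h4 := prob_compl_eq_one_sub₀ hN
  rw [Set.preimage_compl, h4, hE, ← hs]
  simp

/-- For every `0 < p < 1` there exist a constant `C > 0`, a real `q` with `0 < q < 1` and `n₀`
such that for all `n ≥ n₀`: if `X₁,…,Xₙ` are i.i.d. `Binomial(⌈C·log n⌉, p)`, then with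
probability at least `q` the maximum is attained at exactly one index. -/
theorem iid_binomial_unique_max :
    ∀ p : ℝ, 0 < p → p < 1 →
      ∃ (C q : ℝ) (n₀ : ℕ), 0 < C ∧ 0 < q ∧ q < 1 ∧
        ∀ n : ℕ, n₀ ≤ n →
          ∀ (Ω : Type) (_ : MeasurableSpace Ω) (μ : Measure Ω), IsProbabilityMeasure μ →
            ∀ X : Fin n → Ω → ℕ, IsIIDBinomial μ X ⌈C * Real.log n⌉₊ p →
              μ {ω | ∃! i : Fin n, X i ω = Finset.univ.sup (fun j => X j ω)} ≥
                ENNReal.ofReal q := by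
  intro p hp0 hp1
  have hl : 0 < -Real.log p := by have := Real.log_neg hp0 hp1; linarith
  refine ⟨(-Real.log p)⁻¹, p * Real.exp (-1), 2, by positivity, by positivity, ?_, ?_⟩
  · have : Real.exp (-1) ≤ 1 := Real.exp_le_one_iff.2 (by norm_num)
    nlinarith [Real.exp_pos (-1)]
  intro n hn Ω _ μ _ X ⟨hind, hX⟩
  have hnum := aux_num p hp0 hp1 n hn _ rfl
  set m := ⌈(-Real.log p)⁻¹ * Real.log n⌉₊ with hm
  have hone := fun i => aux_one μ p hp0 hp1 m (X i) (hX i)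
  have ht0 : 0 ≤ p ^ m := by positivity
  have ht1 : p ^ m ≤ 1 := pow_le_one₀ hp0.le hp1.le
  let S : Fin n → Fin n → Set ℕ := fun i j => if j = i then {m} else {m}ᶜ
  let A : Fin n → Set Ω := fun i => ⋂ j ∈ (Finset.univ : Finset (Fin n)), X j ⁻¹' S i j
  have hA : ∀ i, μ (A i) = ENNReal.ofReal (p ^ m * (1 - p ^ m) ^ (n - 1)) := by
    intro i
    have h1 := hind.measure_inter_preimage_eq_mul Finset.univ (sets := S i)
      (fun _ _ => MeasurableSet.of_discrete)
    change μ (⋂ j ∈ (Finset.univ : Finset (Fin n)), X j ⁻¹' S i j) = _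
    rw [h1, ← Finset.mul_prod_erase _ _ (Finset.mem_univ i)]
    have h2 : ∏ j ∈ Finset.univ.erase i, μ (X j ⁻¹' S i j) =
        ∏ j ∈ Finset.univ.erase i, ENNReal.ofReal (1 - p ^ m) := by
      refine Finset.prod_congr rfl fun j hj => ?_
      simp only [S, if_neg (Finset.ne_of_mem_erase hj)]
      exact (hone j).2.2.1
    rw [h2, Finset.prod_const, Finset.card_erase_of_mem (Finset.mem_univ i), Finset.card_univ,
      Fintype.card_fin]
    simp only [S, if_true]
    rw [(hone i).2.1, ENNReal.ofReal_mul ht0, ENNReal.ofReal_pow (p := 1 - p ^ m) (by linarith)]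
  have hAn : ∀ i, NullMeasurableSet (A i) μ := by
    intro i
    refine Finset.nullMeasurableSet_biInter _ fun j _ => ?_
    by_cases hji : j = i
    · simp only [S, if_pos hji]; exact (hone j).2.2.2
    · simp only [S, if_neg hji]; exact (hone j).2.2.2.compl
  have memA : ∀ i ω, ω ∈ A i → X i ω = m ∧ ∀ j, j ≠ i → X j ω ≠ m := by
    intro i ω hω
    simp only [A, Set.mem_iInter, Set.mem_preimage] at hω
    refine ⟨by simpa [S] using hω i (Finset.mem_univ _), fun j hj => ?_⟩
    simpa [S, hj] using hω j (Finset.mem_univ _)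
  have hdisj : Pairwise (Function.onFun (AEDisjoint μ) A) := by
    intro i j hij
    apply Disjoint.aedisjoint
    rw [Set.disjoint_left]
    intro ω h1 h2
    exact (memA j ω h2).2 i hij (memA i ω h1).1
  have hU : μ (⋃ i, A i) = ENNReal.ofReal (n * (p ^ m * (1 - p ^ m) ^ (n - 1))) := by
    rw [measure_iUnion₀ hdisj hAn, tsum_fintype]
    simp_rw [hA]
    rw [Finset.sum_const, Finset.card_univ, Fintype.card_fin, nsmul_eq_mul,
      ENNReal.ofReal_mul (p := (n : ℝ)) (by positivity), ENNReal.ofReal_natCast]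
  have hG : μ (⋃ i, {ω | m < X i ω}) = 0 := measure_iUnion_null fun i => (hone i).1
  have hsub : (⋃ i, A i) ⊆ {ω | ∃! i : Fin n, X i ω = Finset.univ.sup (fun j => X j ω)} ∪
      ⋃ i, {ω | m < X i ω} := by
    intro ω hω
    obtain ⟨i, hi⟩ := Set.mem_iUnion.1 hω
    obtain ⟨hi1, hi2⟩ := memA i ω hi
    by_cases hb : ω ∈ ⋃ i, {ω | m < X i ω}
    · exact Or.inr hb
    · left
      simp only [Set.mem_iUnion, Set.mem_setOf_eq, not_exists, not_lt] at hb
      have hsup : Finset.univ.sup (fun j => X j ω) = m := by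
        apply le_antisymm
        · exact Finset.sup_le fun j _ => hb j
        · rw [← hi1]
          exact Finset.le_sup (f := fun j => X j ω) (Finset.mem_univ i)
      refine ⟨i, ?_, fun j hj => ?_⟩
      · change X i ω = _
        rw [hsup, hi1]
      · by_contra hne
        exact hi2 j hne (hj.trans hsup)
  calc ENNReal.ofReal (p * Real.exp (-1)) ≤ μ (⋃ i, A i) := by
        rw [hU]; exact ENNReal.ofReal_le_ofReal hnum
    _ ≤ _ := measure_mono hsub
    _ ≤ _ := measure_union_le _ _
    _ = _ := by rw [hG, add_zero]

end
end

section
/- For every real p with 0 < p < 1 there exist constants C > 0, K > 0 and n₀ ∈ ℕ such that for all integers n ≥ n₀: if X₁,…,Xₙ are i.i.d. Binomial(⌈C·log n⌉, p) random variables, then with probability at least 1 − 1/n the number of indices attaining the maximum is at most K·log n, i.e., P(|{i ∈ {1,…,n} : X_i = max_{1 ≤ j ≤ n} X_j}| ≤ K·log n) ≥ 1 − 1/n. -/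
open MeasureTheory ProbabilityTheory
open scoped ENNReal

noncomputable section

lemma binomPMF_nonneg' {p : ℝ} (h0 : 0 < p) (h1 : p < 1) (m k : ℕ) : 0 ≤ binomPMF m p k := by
  have : 0 ≤ 1 - p := by linarith
  unfold binomPMF; positivity

lemma binomPMF_ratio {p ε : ℝ} (h0 : 0 < p) (h1 : p < 1) (m k : ℕ)
    (hε : 0 ≤ ε) (hk : (k : ℝ) + ε * m < m) : ε * p * binomPMF m p k ≤ binomPMF m p (k + 1) := by
  have hq : 0 ≤ 1 - p := by linarith
  have hkm : k < m := by
    have : (k : ℝ) < m := by nlinarith [mul_nonneg hε (Nat.cast_nonneg (α := ℝ) m)]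
    exact_mod_cast this
  have hm : (0 : ℝ) < m := by exact_mod_cast (by omega : 0 < m)
  have hc : (m.choose (k + 1) : ℝ) * (k + 1) = m.choose k * ((m : ℝ) - k) := by
    have := Nat.choose_succ_right_eq m k
    have h2 : ((m - k : ℕ) : ℝ) = (m : ℝ) - k := Nat.cast_sub hkm.le
    rw [← h2]; exact_mod_cast this
  have h3 : ε * m.choose k ≤ m.choose (k + 1) := by
    have hk1 : (k : ℝ) + 1 ≤ m := by exact_mod_cast hkm
    have a1 : (m.choose (k + 1) : ℝ) * (k + 1) ≤ m.choose (k + 1) * m := by gcongr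
    have a2 : (m.choose k : ℝ) * (ε * m) ≤ m.choose k * ((m : ℝ) - k) := by
      gcongr; linarith
    have : (ε * m.choose k) * m ≤ m.choose (k + 1) * (m : ℝ) := by linarith
    exact le_of_mul_le_mul_right this hm
  have h4 : (1 - p) ^ (m - k) ≤ (1 - p) ^ (m - (k + 1)) :=
    pow_le_pow_of_le_one hq (by linarith) (by omega)
  unfold binomPMF
  calc ε * p * (m.choose k * p ^ k * (1 - p) ^ (m - k))
      = (ε * m.choose k) * p ^ (k + 1) * (1 - p) ^ (m - k) := by ring
    _ ≤ _ := by gcongr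

lemma binomPMF_sum (p : ℝ) (m : ℕ) : ∑ k ∈ Finset.range (m + 1), binomPMF m p k = 1 := by
  have := add_pow p (1 - p) m
  simp only [add_sub_cancel, one_pow] at this
  rw [this]
  refine Finset.sum_congr rfl fun k _ => ?_
  unfold binomPMF; ring

lemma binomPMF_tail {p δ ε : ℝ} (h0 : 0 < p) (h1 : p < 1) (m : ℕ)
    (hδ : δ = -Real.log ((1 + p) / 2)) (hε : ε * Real.log 2 = δ / 2) :
    ∑ k ∈ (Finset.range (m + 1)).filter (fun k : ℕ => (m : ℝ) ≤ k + ε * m), binomPMF m p k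
      ≤ Real.exp (-(δ / 2) * m) := by
  have hq : 0 ≤ 1 - p := by linarith
  have key : ∀ k ∈ (Finset.range (m + 1)).filter (fun k : ℕ => (m : ℝ) ≤ k + ε * m),
      binomPMF m p k ≤ Real.exp (δ / 2 * m) * (p ^ k * ((1 - p) / 2) ^ (m - k) * m.choose k) := by
    intro k hk
    simp only [Finset.mem_filter, Finset.mem_range] at hk
    have hkm : k ≤ m := by omega
    have e : (2 : ℝ) ^ (m - k) ≤ Real.exp (δ / 2 * m) := by
      rw [← Real.exp_log (show (0 : ℝ) < 2 ^ (m - k) by positivity), Real.log_pow,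
        Nat.cast_sub hkm, ← hε]
      apply Real.exp_le_exp.2
      have := Real.log_pos (show (1 : ℝ) < 2 by norm_num)
      have : ((m : ℝ) - k) * Real.log 2 ≤ (ε * m) * Real.log 2 := by gcongr; linarith [hk.2]
      linarith
    unfold binomPMF
    calc (m.choose k : ℝ) * p ^ k * (1 - p) ^ (m - k)
        = 2 ^ (m - k) * (p ^ k * ((1 - p) / 2) ^ (m - k) * m.choose k) := by
          rw [div_pow]; field_simp
      _ ≤ _ := by gcongr
  refine (Finset.sum_le_sum key).trans ?_
  rw [← Finset.mul_sum]
  have h2 : ∑ k ∈ (Finset.range (m + 1)).filter (fun k : ℕ => (m : ℝ) ≤ k + ε * m),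
      (p ^ k * ((1 - p) / 2) ^ (m - k) * m.choose k) ≤ ((1 + p) / 2) ^ m := by
    have : (1 + p) / 2 = p + (1 - p) / 2 := by ring
    rw [this, add_pow]
    apply Finset.sum_le_sum_of_subset_of_nonneg (Finset.filter_subset _ _)
    intros; positivity
  have h3 : ((1 + p) / 2) ^ m = Real.exp (-δ * m) := by
    rw [hδ, neg_neg, mul_comm, Real.exp_nat_mul, Real.exp_log (by linarith)]
  calc _ ≤ Real.exp (δ / 2 * m) * ((1 + p) / 2) ^ m := by gcongr
    _ = _ := by rw [h3, ← Real.exp_add]; congr 1; ring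

lemma ek_real {p c η K' : ℝ} {n m k : ℕ} (h0 : 0 < p) (h1 : p < 1) (hc : 0 < c) (hkm : k < m)
    (hr : c * binomPMF m p k ≤ binomPMF m p (k + 1))
    (hη : ∀ s : ℕ, K' < s → (1 / (1 + c)) ^ s ≤ η) :
    ∑ S ∈ (Finset.univ : Finset (Finset (Fin n))).filter (fun S => K' < (S.card : ℝ)),
      binomPMF m p k ^ S.card * (∑ j ∈ Finset.range k, binomPMF m p j) ^ (n - S.card) ≤ η := by
  have hη0 : 0 ≤ η := by
    obtain ⟨s, hs⟩ := exists_nat_gt K'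
    exact le_trans (by positivity) (hη s hs)
  set a := binomPMF m p k with ha
  set b := ∑ j ∈ Finset.range k, binomPMF m p j with hb
  have ha0 : 0 ≤ a := binomPMF_nonneg' h0 h1 _ _
  have hb0 : 0 ≤ b := Finset.sum_nonneg fun _ _ => binomPMF_nonneg' h0 h1 _ _
  have hsum : b + a + binomPMF m p (k + 1) ≤ 1 := by
    rw [← binomPMF_sum p m, hb, ha, ← Finset.sum_range_succ, ← Finset.sum_range_succ]
    apply Finset.sum_le_sum_of_subset_of_nonneg
    · intro x; simp; omega
    · intros; exact binomPMF_nonneg' h0 h1 _ _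
  have had : a ≤ (1 / (1 + c)) * (1 - b) := by
    rw [div_mul_eq_mul_div, le_div_iff₀ (by linarith)]; linarith
  have hd0 : 0 ≤ 1 - b := by have := binomPMF_nonneg' h0 h1 m (k+1); linarith
  calc _ ≤ ∑ S ∈ (Finset.univ : Finset (Finset (Fin n))).filter (fun S => K' < (S.card : ℝ)),
      η * ((1 - b) ^ S.card * b ^ (n - S.card)) := by
        apply Finset.sum_le_sum
        intro S hS
        have := hη S.card (by simpa using hS)
        calc a ^ S.card * b ^ (n - S.card)
          ≤ ((1 / (1 + c)) * (1 - b)) ^ S.card * b ^ (n - S.card) := by gcongr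
          _ = (1 / (1 + c)) ^ S.card * ((1 - b) ^ S.card * b ^ (n - S.card)) := by
            rw [mul_pow]; ring
          _ ≤ _ := by gcongr
    _ ≤ ∑ S : Finset (Fin n), η * ((1 - b) ^ S.card * b ^ (n - S.card)) := by
        apply Finset.sum_le_sum_of_subset_of_nonneg (Finset.filter_subset _ _)
        intros; positivity
    _ = η := by
        rw [← Finset.mul_sum]
        have := Fin.sum_pow_mul_eq_add_pow (n := n) (1 - b) b
        rw [this]; simp

lemma ek_meas {Ω : Type} [MeasurableSpace Ω] {μ : Measure Ω} {p : ℝ} {n m : ℕ}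
    (h0 : 0 < p) (h1 : p < 1) {X : Fin n → Ω → ℕ} (hX : IsIIDBinomial μ X m p) (k : ℕ)
    (S : Finset (Fin n)) :
    μ {ω | (∀ i ∈ S, X i ω = k) ∧ ∀ i ∉ S, X i ω < k} ≤
      ENNReal.ofReal (binomPMF m p k ^ S.card *
        (∑ j ∈ Finset.range k, binomPMF m p j) ^ (n - S.card)) := by
  obtain ⟨hI, hd⟩ := hX
  have hb : ∀ i, μ (X i ⁻¹' Set.Iio k) ≤
      ENNReal.ofReal (∑ j ∈ Finset.range k, binomPMF m p j) := by
    intro i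
    have : X i ⁻¹' Set.Iio k = ⋃ j ∈ Finset.range k, {ω | X i ω = j} := by
      ext ω; simp
    rw [this, ENNReal.ofReal_sum_of_nonneg fun _ _ => binomPMF_nonneg' h0 h1 _ _]
    refine (measure_biUnion_finset_le _ _).trans ?_
    simp [hd]
  have hset : {ω | (∀ i ∈ S, X i ω = k) ∧ ∀ i ∉ S, X i ω < k} =
      ⋂ i ∈ (Finset.univ : Finset (Fin n)), X i ⁻¹' (if i ∈ S then {k} else Set.Iio k) := by
    ext ω
    simp only [Set.mem_setOf_eq, Finset.mem_univ, Set.iInter_true, Set.mem_iInter,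
      Set.mem_preimage]
    constructor
    · rintro ⟨h, h'⟩ i
      split_ifs with hi
      · exact h i hi
      · exact h' i hi
    · intro h
      constructor
      · intro i hi; simpa [hi] using h i
      · intro i hi; simpa [hi] using h i
  rw [hset, hI.measure_inter_preimage_eq_mul Finset.univ (fun i _ => MeasurableSet.of_discrete)]
  have hS : n - S.card = Sᶜ.card := by simp [Finset.card_compl]
  have hb0 : 0 ≤ ∑ j ∈ Finset.range k, binomPMF m p j :=
    Finset.sum_nonneg fun _ _ => binomPMF_nonneg' h0 h1 _ _
  rw [hS, ENNReal.ofReal_mul (pow_nonneg (binomPMF_nonneg' h0 h1 _ _) _),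
    ENNReal.ofReal_pow (binomPMF_nonneg' h0 h1 _ _), ENNReal.ofReal_pow hb0,
    ← Finset.prod_mul_prod_compl S, ← Finset.prod_const, ← Finset.prod_const]
  gcongr with i hi i hi
  · simp only [hi, if_true]; exact (hd i k).le
  · have : i ∉ S := by simpa using hi
    simp only [this, if_false]; exact hb i

lemma tail_meas {Ω : Type} [MeasurableSpace Ω] {μ : Measure Ω} {p ε : ℝ} {n m : ℕ}
    (h0 : 0 < p) (h1 : p < 1) {X : Fin n → Ω → ℕ} (hX : IsIIDBinomial μ X m p) (i : Fin n) :
    μ {ω | (m : ℝ) ≤ X i ω + ε * m} ≤ ENNReal.ofReal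
      (∑ k ∈ (Finset.range (m + 1)).filter (fun k : ℕ => (m : ℝ) ≤ k + ε * m), binomPMF m p k) := by
  obtain ⟨hI, hd⟩ := hX
  have hz : μ (⋃ j : ℕ, {ω | X i ω = m + 1 + j}) = 0 := by
    rw [measure_iUnion_null_iff]
    intro j
    rw [hd, binomPMF, Nat.choose_eq_zero_of_lt (by omega)]; simp
  have hsub : {ω | (m : ℝ) ≤ X i ω + ε * m} ⊆
      (⋃ k ∈ (Finset.range (m + 1)).filter (fun k : ℕ => (m : ℝ) ≤ k + ε * m), {ω | X i ω = k}) ∪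
      ⋃ j : ℕ, {ω | X i ω = m + 1 + j} := by
    intro ω hω
    by_cases h : X i ω < m + 1
    · left; simp only [Set.mem_iUnion, Finset.mem_filter, Finset.mem_range]
      exact ⟨X i ω, ⟨h, hω⟩, rfl⟩
    · right; simp only [Set.mem_iUnion]
      exact ⟨X i ω - (m + 1), by simp only [Set.mem_setOf_eq]; omega⟩
  refine (measure_mono hsub).trans ((measure_union_le _ _).trans ?_)
  rw [hz, add_zero, ENNReal.ofReal_sum_of_nonneg fun _ _ => binomPMF_nonneg' h0 h1 _ _]
  refine (measure_biUnion_finset_le _ _).trans ?_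
  simp [hd]

/-- For every `0 < p < 1` there exist constants `C > 0`, `K > 0` and `n₀` such that for all
`n ≥ n₀`: if `X₁,…,Xₙ` are i.i.d. `Binomial(⌈C·log n⌉, p)`, then with probability at least
`1 − 1/n` the number of indices attaining the maximum is at most `K·log n`. -/
theorem iid_binomial_few_maxima :
    ∀ p : ℝ, 0 < p → p < 1 →
      ∃ (C K : ℝ) (n₀ : ℕ), 0 < C ∧ 0 < K ∧
        ∀ n : ℕ, n₀ ≤ n →
          ∀ (Ω : Type) (_ : MeasurableSpace Ω) (μ : Measure Ω), IsProbabilityMeasure μ →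
            ∀ X : Fin n → Ω → ℕ, IsIIDBinomial μ X ⌈C * Real.log n⌉₊ p →
              μ {ω | ((Finset.univ.filter
                    (fun i : Fin n => X i ω = Finset.univ.sup (fun j => X j ω))).card : ℝ)
                  ≤ K * Real.log n} ≥ 1 - (n : ℝ≥0∞)⁻¹ := by
  intro p h0 h1
  obtain ⟨δ, hδ⟩ : ∃ δ, δ = -Real.log ((1 + p) / 2) := ⟨_, rfl⟩
  have hδ0 : 0 < δ := by
    rw [hδ]; have := Real.log_neg (show 0 < (1 + p) / 2 by linarith) (by linarith); linarith
  have hl2 := Real.log_pos (show (1 : ℝ) < 2 by norm_num)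
  obtain ⟨ε, hε⟩ : ∃ ε, ε = δ / 2 / Real.log 2 := ⟨_, rfl⟩
  have hε0 : 0 < ε := by rw [hε]; positivity
  have hε' : ε * Real.log 2 = δ / 2 := by rw [hε]; field_simp
  obtain ⟨c, hcd⟩ : ∃ c, c = ε * p := ⟨_, rfl⟩
  have hc : 0 < c := by rw [hcd]; positivity
  have hlc : 0 < Real.log (1 + c) := Real.log_pos (by linarith)
  have hev : ∀ᶠ n : ℕ in Filter.atTop, 6 / δ * Real.log n ≤ (1 / 2) * n := by
    have h := Real.isLittleO_log_id_atTop.comp_tendsto (tendsto_natCast_atTop_atTop (R := ℝ))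
    have := h.const_mul_left (6 / δ)
    have := this.bound (show (0 : ℝ) < 1 / 2 by norm_num)
    filter_upwards [this] with n hn
    simp only [Function.comp, id, Real.norm_eq_abs, Nat.abs_cast] at hn
    exact (le_abs_self _).trans hn
  obtain ⟨N, hN⟩ := Filter.eventually_atTop.1 hev
  refine ⟨6 / δ, 3 / Real.log (1 + c), max N 2, by positivity, by positivity, ?_⟩
  intro n hn Ω _ μ hμ X hX
  have hn2 : 2 ≤ n := le_trans (le_max_right _ _) hn
  have hnR : (2 : ℝ) ≤ n := by exact_mod_cast hn2
  have hlog := hN n (le_trans (le_max_left _ _) hn)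
  have hlogn : 0 ≤ Real.log n := Real.log_nonneg (by linarith)
  obtain ⟨m, hm⟩ : ∃ m, m = ⌈6 / δ * Real.log n⌉₊ := ⟨_, rfl⟩
  rw [← hm] at hX
  have hm1 : 6 / δ * Real.log n ≤ m := hm ▸ Nat.le_ceil _
  have hm2 : (m : ℝ) ≤ n := by
    have := Nat.ceil_lt_add_one (show 0 ≤ 6 / δ * Real.log n by positivity)
    rw [← hm] at this; linarith
  obtain ⟨η, hη⟩ : ∃ η : ℝ, η = ((n : ℝ) ^ 3)⁻¹ := ⟨_, rfl⟩
  have hη0 : 0 ≤ η := by rw [hη]; positivity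
  have hηe : η = Real.exp (-(3 * Real.log n)) := by
    rw [hη, Real.exp_neg]
    congr 1
    have := Real.exp_nat_mul (Real.log n) 3
    push_cast at this
    rw [this, Real.exp_log (by linarith)]
  obtain ⟨K', hK'⟩ : ∃ K', K' = 3 / Real.log (1 + c) * Real.log n := ⟨_, rfl⟩
  have hK0 : 0 ≤ K' := by rw [hK']; positivity
  rw [← hK']
  have hpow : ∀ s : ℕ, K' < s → (1 / (1 + c)) ^ s ≤ η := by
    intro s hs
    have : (1 / (1 + c)) ^ s = Real.exp (-(s * Real.log (1 + c))) := by
      rw [Real.exp_neg, Real.exp_nat_mul, Real.exp_log (by linarith), one_div, inv_pow]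
    rw [this, hηe]
    apply Real.exp_le_exp.2
    have : K' * Real.log (1 + c) = 3 * Real.log n := by rw [hK']; field_simp
    have := mul_le_mul_of_nonneg_right hs.le hlc.le
    linarith
  have htail : ∀ i, μ {ω | (m : ℝ) ≤ X i ω + ε * m} ≤ ENNReal.ofReal η := by
    intro i
    refine (tail_meas h0 h1 hX i).trans (ENNReal.ofReal_le_ofReal ?_)
    refine (binomPMF_tail h0 h1 m hδ hε').trans ?_
    rw [hηe]
    apply Real.exp_le_exp.2
    have h := mul_le_mul_of_nonneg_left hm1 (show 0 ≤ δ / 2 by linarith)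
    have : δ / 2 * (6 / δ * Real.log n) = 3 * Real.log n := by field_simp; ring
    linarith
  let low := (Finset.range m).filter (fun k : ℕ => (k : ℝ) + ε * m < m)
  let big := (Finset.univ : Finset (Finset (Fin n))).filter (fun S => K' < (S.card : ℝ))
  let E : ℕ → Finset (Fin n) → Set Ω := fun k S =>
    {ω | (∀ i ∈ S, X i ω = k) ∧ ∀ i ∉ S, X i ω < k}
  have hEk : ∀ k ∈ low, μ (⋃ S ∈ big, E k S) ≤ ENNReal.ofReal η := by
    intro k hk
    simp only [low, Finset.mem_filter, Finset.mem_range] at hk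
    refine (measure_biUnion_finset_le _ _).trans ?_
    refine (Finset.sum_le_sum fun S _ => ek_meas h0 h1 hX k S).trans ?_
    rw [← ENNReal.ofReal_sum_of_nonneg]
    · apply ENNReal.ofReal_le_ofReal
      apply ek_real h0 h1 hc hk.1 _ hpow
      rw [hcd]; exact binomPMF_ratio h0 h1 m k hε0.le hk.2
    · intro S _
      exact mul_nonneg (pow_nonneg (binomPMF_nonneg' h0 h1 _ _) _)
        (pow_nonneg (Finset.sum_nonneg fun _ _ => binomPMF_nonneg' h0 h1 _ _) _)
  set G := {ω | ((Finset.univ.filter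
                    (fun i : Fin n => X i ω = Finset.univ.sup (fun j => X j ω))).card : ℝ)
                  ≤ K'} with hG
  have hsub : Gᶜ ⊆ (⋃ i ∈ (Finset.univ : Finset (Fin n)), {ω | (m : ℝ) ≤ X i ω + ε * m}) ∪
      ⋃ k ∈ low, ⋃ S ∈ big, E k S := by
    intro ω hω
    simp only [hG, Set.mem_compl_iff, Set.mem_setOf_eq, not_le] at hω
    set S := Finset.univ.filter
                    (fun i : Fin n => X i ω = Finset.univ.sup (fun j => X j ω)) with hS
    have hpos : 0 < S.card := by
      have : (0 : ℝ) < S.card := lt_of_le_of_lt hK0 hω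
      exact_mod_cast this
    obtain ⟨i, hi⟩ := Finset.card_pos.1 hpos
    have hi' : X i ω = Finset.univ.sup (fun j => X j ω) := by simpa [hS] using hi
    by_cases h : (m : ℝ) ≤ X i ω + ε * m
    · left; simp only [Set.mem_iUnion]; exact ⟨i, Finset.mem_univ _, h⟩
    · right
      push Not at h
      simp only [Set.mem_iUnion]
      refine ⟨X i ω, ?_, S, ?_, ?_, ?_⟩
      · simp only [low, Finset.mem_filter, Finset.mem_range]
        refine ⟨?_, h⟩
        have : (X i ω : ℝ) < m := by
          have : 0 ≤ ε * m := by positivity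
          linarith
        exact_mod_cast this
      · simp only [big, Finset.mem_filter]; exact ⟨Finset.mem_univ _, hω⟩
      · intro j hj
        have : X j ω = Finset.univ.sup (fun j => X j ω) := by simpa [hS] using hj
        rw [this, hi']
      · intro j hj
        have hne : X j ω ≠ Finset.univ.sup (fun j => X j ω) := by simpa [hS] using hj
        rw [hi']
        exact lt_of_le_of_ne (Finset.le_sup (f := fun j => X j ω) (Finset.mem_univ j)) hne
  have hGc : μ Gᶜ ≤ (n : ℝ≥0∞)⁻¹ := by
    have hu1 : μ (⋃ i ∈ (Finset.univ : Finset (Fin n)), {ω | (m : ℝ) ≤ X i ω + ε * m}) ≤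
        n * ENNReal.ofReal η := by
      refine (measure_biUnion_finset_le _ _).trans ?_
      refine (Finset.sum_le_sum fun i _ => htail i).trans ?_
      simp
    have hu2 : μ (⋃ k ∈ low, ⋃ S ∈ big, E k S) ≤ m * ENNReal.ofReal η := by
      refine (measure_biUnion_finset_le _ _).trans ?_
      refine (Finset.sum_le_sum hEk).trans ?_
      rw [Finset.sum_const, nsmul_eq_mul]
      gcongr
      exact (Finset.card_filter_le _ _).trans (by simp)
    refine (measure_mono hsub).trans ((measure_union_le _ _).trans ((add_le_add hu1 hu2).trans ?_))
    have e1 : (n : ℝ≥0∞)⁻¹ = ENNReal.ofReal ((n : ℝ)⁻¹) := by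
      rw [ENNReal.ofReal_inv_of_pos (by linarith), ENNReal.ofReal_natCast]
    rw [e1, ← ENNReal.ofReal_natCast n, ← ENNReal.ofReal_natCast m,
      ← ENNReal.ofReal_mul (by positivity), ← ENNReal.ofReal_mul (by positivity),
      ← ENNReal.ofReal_add (by positivity) (by positivity)]
    apply ENNReal.ofReal_le_ofReal
    have hle : (n : ℝ) + m ≤ n ^ 2 := by nlinarith
    calc (n : ℝ) * η + m * η = (n + m) * η := by ring
      _ ≤ n ^ 2 * η := by gcongr
      _ = (n : ℝ)⁻¹ := by rw [hη]; field_simp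
  have huniv : (1 : ℝ≥0∞) ≤ μ G + μ Gᶜ := by
    rw [← measure_univ (μ := μ), ← Set.union_compl_self G]; exact measure_union_le _ _
  rw [ge_iff_le, tsub_le_iff_right]
  exact huniv.trans (by gcongr)


end
end

section
/- For every real p with 0 < p < 1 there exist a constant C > 0, a real ρ > 1, and n₀ ∈ ℕ such that for all integers n ≥ n₀ the following holds. Set m = ⌈C·log n⌉ and P_j = C(m,j)·p^j·(1−p)^{m−j}. Then there exists a natural number k < m with P_k ≥ 1/n, P_{k+1} < 1/n, and P_j / P_{j+1} ≥ ρ for every j with k ≤ j < m. -/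
noncomputable section

lemma bp_pos {m : ℕ} {p : ℝ} (h0 : 0 < p) (h1 : p < 1) {k : ℕ} (hk : k ≤ m) :
    0 < binomPMF m p k := by
  unfold binomPMF
  have := Nat.choose_pos hk
  have h2 : 0 < 1 - p := by linarith
  positivity

lemma bp_succ {m : ℕ} {p : ℝ} {k : ℕ} (hk : k < m) :
    binomPMF m p (k + 1) * ((k + 1) * (1 - p)) = binomPMF m p k * ((m - k) * p) := by
  unfold binomPMF
  have h := Nat.choose_succ_right_eq m k
  have h' : (m.choose (k+1) : ℝ) * (k + 1) = m.choose k * (m - k) := by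
    rw [← Nat.cast_sub hk.le]; exact_mod_cast h
  have e : m - k = (m - (k + 1)) + 1 := by omega
  rw [e, pow_succ, pow_succ]
  linear_combination (p ^ k * p * (1 - p) ^ (m - (k+1)) * (1 - p)) * h'

lemma bp_mode (m : ℕ) {q : ℝ} (h0 : 0 < q) (h1 : q < 1) :
    ∃ j ≤ m, 1 ≤ (m + 1) * binomPMF m q j ∧ (m + 1) * q ≤ (j : ℝ) + 1 := by
  obtain ⟨j, hj, hmax⟩ := Finset.exists_max_image (Finset.range (m + 1)) (binomPMF m q) ⟨0, by simp⟩
  have hjm : j ≤ m := by simpa [Nat.lt_succ_iff] using hj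
  refine ⟨j, hjm, ?_, ?_⟩
  · have hs : ∑ i ∈ Finset.range (m + 1), binomPMF m q i = 1 := by
      have := add_pow q (1 - q) m
      rw [add_sub_cancel, one_pow] at this
      rw [this]
      refine Finset.sum_congr rfl fun i _ => ?_
      unfold binomPMF; ring
    have := Finset.sum_le_card_nsmul _ _ _ hmax
    rw [hs] at this
    simpa using this
  · rcases hjm.lt_or_eq with h | h
    · have hs := bp_succ (p := q) h
      have hm := hmax (j + 1) (by simp; omega)
      have hp := bp_pos h0 h1 hjm
      have h3 : binomPMF m q (j + 1) * ((j + 1) * (1 - q)) ≤ binomPMF m q j * ((j + 1) * (1 - q)) := by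
        apply mul_le_mul_of_nonneg_right hm
        have : 0 < 1 - q := by linarith
        positivity
      rw [hs] at h3
      have := le_of_mul_le_mul_left h3 hp
      nlinarith
    · subst h
      have : (0:ℝ) ≤ j := by positivity
      nlinarith

lemma bp_tilt {m j : ℕ} {q : ℝ} (h0 : 0 < q) (h1 : q < 1) (hj : j ≤ m) :
    q ^ m * binomPMF m q j ≤ binomPMF m (q ^ 2) j := by
  unfold binomPMF
  have e : (1 - q ^ 2) = (1 - q) * (1 + q) := by ring
  have e2 : q ^ m = q ^ j * q ^ (m - j) := by rw [← pow_add]; congr 1; omega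
  have h2 : 0 < 1 - q := by linarith
  have h3 : q ^ (m - j) ≤ (1 + q) ^ (m - j) := by gcongr; linarith
  rw [e, mul_pow, e2]
  calc _ = (m.choose j * q ^ j * q ^ j * (1 - q) ^ (m - j)) * q ^ (m - j) := by ring
    _ ≤ (m.choose j * q ^ j * q ^ j * (1 - q) ^ (m - j)) * (1 + q) ^ (m - j) := by gcongr
    _ = _ := by ring

/-- For every `0 < p < 1` there exist `C > 0`, `ρ > 1` and `n₀` such that for all `n ≥ n₀`,
with `m = ⌈C·log n⌉`, there is `k < m` with `P_k ≥ 1/n`, `P_{k+1} < 1/n`, and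
`P_j / P_{j+1} ≥ ρ` for all `k ≤ j < m`. -/
theorem binomial_threshold_with_ratio :
    ∀ p : ℝ, 0 < p → p < 1 →
      ∃ (C ρ : ℝ) (n₀ : ℕ), 0 < C ∧ 1 < ρ ∧
        ∀ n : ℕ, n₀ ≤ n →
          ∃ k : ℕ, k < ⌈C * Real.log n⌉₊ ∧
            binomPMF ⌈C * Real.log n⌉₊ p k ≥ 1 / (n : ℝ) ∧
            binomPMF ⌈C * Real.log n⌉₊ p (k + 1) < 1 / (n : ℝ) ∧
            ∀ j : ℕ, k ≤ j → j < ⌈C * Real.log n⌉₊ →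
              binomPMF ⌈C * Real.log n⌉₊ p j / binomPMF ⌈C * Real.log n⌉₊ p (j + 1) ≥ ρ := by
  intro p hp0 hp1
  obtain ⟨q, hq0, hq1, rfl⟩ : ∃ q : ℝ, 0 < q ∧ q < 1 ∧ p = q ^ 2 :=
    ⟨√p, Real.sqrt_pos.2 hp0, by rw [Real.sqrt_lt' one_pos]; simpa using hp1,
      (Real.sq_sqrt hp0.le).symm⟩
  have hL : Real.log q < 0 := Real.log_neg hq0 hq1
  obtain ⟨L, hLdef⟩ : ∃ L, L = -Real.log q := ⟨_, rfl⟩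
  have hL0 : 0 < L := by linarith
  have hqpow : ∀ m : ℕ, q ^ m = Real.exp (-(L * m)) := by
    intro m
    rw [hLdef, neg_mul, neg_neg, mul_comm, Real.exp_nat_mul, Real.exp_log hq0]
  obtain ⟨C, hC⟩ : ∃ C : ℝ, C = 2 / (3 * L) := ⟨_, rfl⟩
  have hC0 : 0 < C := by rw [hC]; positivity
  have hLC : L * C = 2 / 3 := by rw [hC]; field_simp
  have hlog : Filter.Tendsto (fun n : ℕ => Real.log n) Filter.atTop Filter.atTop :=
    Real.tendsto_log_atTop.comp tendsto_natCast_atTop_atTop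
  obtain ⟨n₀, hn₀⟩ := Filter.eventually_atTop.1
    ((hlog.eventually_ge_atTop 1).and (hlog.eventually_ge_atTop (18 * (C + 2) / q)))
  refine ⟨C, (1 + q) / q, n₀, hC0, by rw [lt_div_iff₀ hq0]; linarith, ?_⟩
  intro n hn
  obtain ⟨hx1, hx2⟩ := hn₀ n hn
  have hn0 : (0:ℝ) < n := by
    rcases Nat.eq_zero_or_pos n with h | h
    · subst h; norm_num at hx1
    · exact_mod_cast h
  have hnx : (1:ℝ) / n = Real.exp (-Real.log n) := by
    rw [Real.exp_neg, Real.exp_log hn0, one_div]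
  have hm1 := Nat.le_ceil (C * Real.log n)
  have hm2 := Nat.ceil_lt_add_one (a := C * Real.log n) (by positivity)
  rw [hnx]
  generalize Real.log n = x at *
  generalize ⌈C * x⌉₊ = m at *
  obtain ⟨j, hjm, hj1, hj2⟩ := bp_mode m hq0 hq1
  have hPj : Real.exp (-x) ≤ binomPMF m (q ^ 2) j := by
    refine le_trans ?_ (bp_tilt hq0 hq1 hjm)
    have a1 : q * Real.exp (-(2 / 3 * x)) ≤ q ^ m := by
      have : q = Real.exp (-L) := by rw [hLdef, neg_neg, Real.exp_log hq0]
      rw [hqpow]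
      nth_rw 1 [this]
      rw [← Real.exp_add]
      apply Real.exp_le_exp.2
      nlinarith
    have a2 : (m : ℝ) + 1 ≤ q * Real.exp (x / 3) := by
      have := Real.quadratic_le_exp_of_nonneg (x := x / 3) (by linarith)
      rw [div_le_iff₀ hq0] at hx2
      have h5 : q * (x ^ 2 / 18) ≤ q * Real.exp (x / 3) := by
        gcongr; nlinarith
      nlinarith
    have a3 : (m + 1) * Real.exp (-x) ≤ q ^ m := by
      refine le_trans ?_ a1
      have : Real.exp (-(2 / 3 * x)) = Real.exp (x / 3) * Real.exp (-x) := by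
        rw [← Real.exp_add]; congr 1; ring
      rw [this, ← mul_assoc]
      gcongr
    have hp := bp_pos hq0 hq1 hjm
    calc Real.exp (-x) = Real.exp (-x) * 1 := by ring
      _ ≤ Real.exp (-x) * ((m + 1) * binomPMF m q j) := by gcongr
      _ = ((m + 1) * Real.exp (-x)) * binomPMF m q j := by ring
      _ ≤ _ := by gcongr
  have hPm : binomPMF m (q ^ 2) m < Real.exp (-x) := by
    have : binomPMF m (q ^ 2) m = Real.exp (-(2 * (L * m))) := by
      simp only [binomPMF, Nat.choose_self, Nat.sub_self, pow_zero, Nat.cast_one, one_mul, mul_one]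
      rw [← pow_mul, mul_comm, pow_mul, hqpow, ← Real.exp_nat_mul]
      congr 1; push_cast; ring
    rw [this]
    apply Real.exp_lt_exp.2
    nlinarith
  classical
  let k := Nat.findGreatest (fun i => Real.exp (-x) ≤ binomPMF m (q ^ 2) i) m
  have hk : Real.exp (-x) ≤ binomPMF m (q ^ 2) k :=
    Nat.findGreatest_spec (P := fun i => Real.exp (-x) ≤ binomPMF m (q ^ 2) i) hjm hPj
  have hjk : j ≤ k := Nat.le_findGreatest hjm hPj
  have hkm : k < m := by
    refine lt_of_le_of_ne (Nat.findGreatest_le m) ?_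
    intro h
    rw [h] at hk
    linarith
  refine ⟨k, hkm, hk, ?_, ?_⟩
  · exact not_le.1 (Nat.findGreatest_is_greatest (P := fun i => Real.exp (-x) ≤ binomPMF m (q ^ 2) i)
      (Nat.lt_succ_self k) hkm)
  · intro i hi him
    have hs := bp_succ (p := q ^ 2) him
    have hp1 := bp_pos hp0 hp1 (Nat.succ_le_of_lt him)
    have hji : (j : ℝ) ≤ i := by exact_mod_cast hjk.trans hi
    have him' : (0:ℝ) < m - i := by
      have : (i : ℝ) < m := by exact_mod_cast him
      linarith
    have hpos : 0 < ((m : ℝ) - i) * q ^ 2 := by positivity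
    rw [ge_iff_le, le_div_iff₀ hp1, div_mul_eq_mul_div, div_le_iff₀ hq0]
    have key : (1 + q) * ((m - i) * q ^ 2) ≤ ((i : ℝ) + 1) * (1 - q ^ 2) * q := by
      have : (m - i) * q ≤ ((i : ℝ) + 1) * (1 - q) := by nlinarith
      have := mul_le_mul_of_nonneg_left this (by positivity : 0 ≤ (1 + q) * q)
      nlinarith
    refine le_of_mul_le_mul_right ?_ hpos
    have := mul_le_mul_of_nonneg_left key hp1.le
    calc _ = binomPMF m (q ^ 2) (i + 1) * ((1 + q) * ((m - i) * q ^ 2)) := by ring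
      _ ≤ _ := this
      _ = (binomPMF m (q ^ 2) (i + 1) * ((i + 1) * (1 - q ^ 2))) * q := by ring
      _ = _ := by rw [hs]; ring

end
end

section
/- In the four-state exact-majority protocol, the difference between the number of strong A opinions and the number of strong B opinions is invariant throughout any computation: for every finite set V, every configuration c₀ : V → S, and every finite sequence of interactions (each interaction given by a pair of distinct nodes, applied successively via δ), the resulting configuration c_T satisfies (|{w ∈ V : c_T(w) = X}| : ℤ) − |{w ∈ V : c_T(w) = Y}| = (|{w ∈ V : c₀(w) = X}| : ℤ) − |{w ∈ V : c₀(w) = Y}|. -/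
/-- The state set of the four-state exact-majority protocol: strong opinions `X`, `Y` and
weak opinions `x`, `y`. -/
inductive MajState : Type
  | X : MajState
  | x : MajState
  | Y : MajState
  | y : MajState
  deriving DecidableEq

open MajState

/-- The transition function of the four-state exact-majority protocol. -/
def majDelta : MajState × MajState → MajState × MajState
  | (X, Y) => (x, y)
  | (Y, X) => (y, x)
  | (X, y) => (x, X)
  | (y, X) => (X, x)
  | (Y, x) => (y, Y)
  | (x, Y) => (Y, y)
  | s => s

/-- An interaction of two distinct nodes `u ≠ v` transforms the configuration `c` into the
configuration agreeing with `c` outside `{u, v}` and with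
`(c' u, c' v) = majDelta (c u, c v)`. -/
def interact {V : Type*} [DecidableEq V] (c : V → MajState) (u v : V) : V → MajState :=
  fun w =>
    if w = u then (majDelta (c u, c v)).1
    else if w = v then (majDelta (c u, c v)).2
    else c w

/-- Apply a finite sequence of interactions successively to an initial configuration. -/
def runInteractions {V : Type*} [DecidableEq V] (c : V → MajState) :
    List (V × V) → (V → MajState)
  | [] => c
  | e :: rest => runInteractions (interact c e.1 e.2) rest

def strongWt (s : MajState) : ℤ := (if s = X then 1 else 0) - (if s = Y then 1 else 0)

theorem strongWt_delta (a b : MajState) :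
    strongWt (majDelta (a, b)).1 + strongWt (majDelta (a, b)).2 = strongWt a + strongWt b := by
  cases a <;> cases b <;> simp [strongWt, majDelta]

theorem diff_eq_sum {V : Type*} [Fintype V] (c : V → MajState) :
    ((Finset.univ.filter (fun w => c w = X)).card : ℤ) -
      ((Finset.univ.filter (fun w => c w = Y)).card : ℤ) = ∑ w, strongWt (c w) := by
  simp [strongWt, Finset.sum_sub_distrib]

theorem sum_interact {V : Type*} [Fintype V] [DecidableEq V] (c : V → MajState) (u v : V)
    (h : u ≠ v) : ∑ w, strongWt (interact c u v w) = ∑ w, strongWt (c w) := by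
  have hv : v ∈ Finset.univ.erase u := by simp [h.symm]
  rw [← Finset.add_sum_erase _ _ (Finset.mem_univ u), ← Finset.add_sum_erase _ _ hv,
    ← Finset.add_sum_erase (a := u) _ (fun w => strongWt (c w)) (Finset.mem_univ u),
    ← Finset.add_sum_erase _ (fun w => strongWt (c w)) hv, ← add_assoc, ← add_assoc]
  congr 1
  · simpa [interact, h.symm] using strongWt_delta (c u) (c v)
  · refine Finset.sum_congr rfl fun w hw => ?_
    simp only [Finset.mem_erase] at hw
    simp [interact, hw.1, hw.2.1]

/-- In the four-state exact-majority protocol, the difference between the number of strong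
`A` opinions (`X`) and the number of strong `B` opinions (`Y`) is invariant throughout any
computation. -/
theorem strong_opinion_difference_invariant
    {V : Type*} [Fintype V] [DecidableEq V]
    (c₀ : V → MajState) (L : List (V × V)) (hL : ∀ e ∈ L, e.1 ≠ e.2) :
    ((Finset.univ.filter (fun w => runInteractions c₀ L w = X)).card : ℤ) -
      ((Finset.univ.filter (fun w => runInteractions c₀ L w = Y)).card : ℤ) =
    ((Finset.univ.filter (fun w => c₀ w = X)).card : ℤ) -
      ((Finset.univ.filter (fun w => c₀ w = Y)).card : ℤ) := by
  rw [diff_eq_sum, diff_eq_sum]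
  induction L generalizing c₀ with
  | nil => rfl
  | cons e rest ih =>
    rw [runInteractions, ih _ (fun e' he => hL e' (List.mem_cons_of_mem _ he)),
      sum_interact _ _ _ (hL e List.mem_cons_self)]
end
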